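/- arXiv:1207.2283 — 9 statements merged into one kernel-verified Lean document; each statement's English description precedes it below -/
import Mathlib

section
/- Let N ≥ 1 and 0 ≤ m ≤ N+1 be integers and let f ∈ C^m[-1,1]. Set σ_{0,N} := 1 and, for m ≥ 1, σ_{m,N} := ∏_{j=1}^{m−1} (N+1)/(N+1−j). Then ‖(I − S_N) f_c‖_{H^m} ≤ σ_{m,N} ‖(f^{(m)})_c‖_{H^0}, where S_N φ := Σ_{|μ| ≤ N} φ̂(μ) exp(iμθ) is the truncated Fourier series. -/
open scoped Real

/-- Fourier coefficient `φ̂(μ) = (1/2π) ∫_{-π}^{π} φ(θ) exp(-iμθ) dθ`. -/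
noncomputable def fourierCoef (φ : ℝ → ℂ) (μ : ℤ) : ℂ :=
  (1 / (2 * (Real.pi : ℂ))) * ∫ θ in (-Real.pi)..Real.pi,
    φ θ * Complex.exp (-Complex.I * (μ : ℂ) * (θ : ℂ))

/-- The periodic Sobolev norm `‖φ‖_{H^m}` with
`‖φ‖_{H^m}² = |φ̂(0)|² + Σ_{μ≠0} |μ|^{2m} |φ̂(μ)|²`. -/
noncomputable def sobolevNorm (m : ℕ) (φ : ℝ → ℂ) : ℝ :=
  Real.sqrt (‖fourierCoef φ 0‖ ^ 2 +
    ∑' μ : {μ : ℤ // μ ≠ 0}, |((μ : ℤ) : ℝ)| ^ (2 * m) * ‖fourierCoef φ (μ : ℤ)‖ ^ 2)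

/-- The truncated Fourier series `S_N φ (θ) = Σ_{|μ| ≤ N} φ̂(μ) exp(iμθ)`. -/
noncomputable def truncFourier (N : ℕ) (φ : ℝ → ℂ) (θ : ℝ) : ℂ :=
  ∑ μ ∈ Finset.Icc (-(N : ℤ)) (N : ℤ),
    fourierCoef φ μ * Complex.exp (Complex.I * (μ : ℂ) * (θ : ℂ))

/-- `σ_{0,N} = 1` and `σ_{m,N} = ∏_{j=1}^{m-1} (N+1)/(N+1-j)` for `m ≥ 1`. -/
noncomputable def sigmaConst (m N : ℕ) : ℝ :=
  ∏ j ∈ Finset.Icc 1 (m - 1), ((N : ℝ) + 1) / ((N : ℝ) + 1 - (j : ℝ))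

open MeasureTheory ENNReal

/-- The squared weighted tail `Σ_{|μ| ≥ K} |μ|^{2m} |c μ|²` with values in `[0, ∞]`. -/
noncomputable def weightedTail (K m : ℕ) (c : ℤ → ℂ) : ℝ≥0∞ :=
  ∑' μ : ℤ, if (K : ℤ) ≤ |μ| then ENNReal.ofReal (|(μ : ℝ)| ^ (2 * m) * ‖c μ‖ ^ 2) else 0

lemma weightedTail_zero_le (K : ℕ) (c : ℤ → ℂ) :
    weightedTail K 0 c ≤ ∑' μ : ℤ, ENNReal.ofReal (‖c μ‖ ^ 2) := by
  refine ENNReal.tsum_le_tsum fun μ => ?_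
  split_ifs <;> simp

lemma abs_pow_le_ratio_pow_mul {K m : ℕ} (hmK : m ≤ K) {x y : ℝ} (hx : (K : ℝ) + 1 ≤ |x|)
    (hxy : |x| ≤ |y| + 1) :
    |x| ^ (2 * m) ≤ (((K : ℝ) + 1) / K) ^ (2 * m) * |y| ^ (2 * m) := by
  rcases Nat.eq_zero_or_pos K with rfl | hK
  · obtain rfl : m = 0 := by omega
    simp
  · have hK' : (0 : ℝ) < K := by exact_mod_cast hK
    rw [← mul_pow]
    refine pow_le_pow_left₀ (abs_nonneg _) ?_ _
    rw [div_mul_eq_mul_div, le_div_iff₀ hK']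
    nlinarith

lemma weightedTail_succ_le {K m : ℕ} (hmK : m ≤ K) {c g : ℤ → ℂ}
    (h : ∀ μ : ℤ, 2 * (μ : ℂ) * c μ = g (μ - 1) - g (μ + 1)) :
    weightedTail (K + 1) (m + 1) c ≤
      ENNReal.ofReal ((((K : ℝ) + 1) / K) ^ (2 * m)) * weightedTail K m g := by
  set r : ℝ := (((K : ℝ) + 1) / K) ^ (2 * m) with hr
  have hr0 : 0 ≤ r := by positivity
  set F : ℤ → ℝ≥0∞ := fun μ =>
    if (K : ℤ) ≤ |μ| then ENNReal.ofReal (|(μ : ℝ)| ^ (2 * m) * ‖g μ‖ ^ 2) else 0 with hF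
  have hterm : ∀ μ : ℤ, (if ((K + 1 : ℕ) : ℤ) ≤ |μ| then
      ENNReal.ofReal (|(μ : ℝ)| ^ (2 * (m + 1)) * ‖c μ‖ ^ 2) else 0) ≤
      ENNReal.ofReal (r / 2) * (F (μ - 1) + F (μ + 1)) := by
    intro μ
    split_ifs with hμ
    swap
    · exact zero_le
    push_cast at hμ
    have h1 : (K : ℤ) ≤ |μ - 1| := by grind
    have h2 : (K : ℤ) ≤ |μ + 1| := by grind
    have hμR : (K : ℝ) + 1 ≤ |(μ : ℝ)| := by exact_mod_cast hμ
    have h3 : |(μ : ℝ)| ≤ |(μ : ℝ) - 1| + 1 := by grind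
    have h4 : |(μ : ℝ)| ≤ |(μ : ℝ) + 1| + 1 := by grind
    have w1 := abs_pow_le_ratio_pow_mul hmK hμR h3
    have w2 := abs_pow_le_ratio_pow_mul hmK hμR h4
    simp only [hF, h1, h2, if_true]
    rw [← ENNReal.ofReal_add (by positivity) (by positivity), ← ENNReal.ofReal_mul (by positivity)]
    refine ENNReal.ofReal_le_ofReal ?_
    push_cast
    rw [← hr] at w1 w2
    have hn : 2 * |(μ : ℝ)| * ‖c μ‖ ≤ ‖g (μ - 1)‖ + ‖g (μ + 1)‖ := by
      have := congrArg norm (h μ)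
      rw [norm_mul, norm_mul, Complex.norm_intCast, Complex.norm_two] at this
      rw [this]
      exact norm_sub_le _ _
    have hsq : |(μ : ℝ)| ^ 2 * ‖c μ‖ ^ 2 ≤ (‖g (μ - 1)‖ ^ 2 + ‖g (μ + 1)‖ ^ 2) / 2 := by
      have := pow_le_pow_left₀ (by positivity) hn 2
      nlinarith [sq_nonneg (‖g (μ - 1)‖ - ‖g (μ + 1)‖)]
    calc |(μ : ℝ)| ^ (2 * (m + 1)) * ‖c μ‖ ^ 2
        = |(μ : ℝ)| ^ (2 * m) * (|(μ : ℝ)| ^ 2 * ‖c μ‖ ^ 2) := by ring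
      _ ≤ |(μ : ℝ)| ^ (2 * m) * ((‖g (μ - 1)‖ ^ 2 + ‖g (μ + 1)‖ ^ 2) / 2) := by gcongr
      _ = (|(μ : ℝ)| ^ (2 * m) * ‖g (μ - 1)‖ ^ 2 + |(μ : ℝ)| ^ (2 * m) * ‖g (μ + 1)‖ ^ 2) / 2 := by
          ring
      _ ≤ (r * |(μ : ℝ) - 1| ^ (2 * m) * ‖g (μ - 1)‖ ^ 2 +
            r * |(μ : ℝ) + 1| ^ (2 * m) * ‖g (μ + 1)‖ ^ 2) / 2 := by gcongr
      _ = _ := by ring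
  calc weightedTail (K + 1) (m + 1) c
      ≤ ∑' μ : ℤ, ENNReal.ofReal (r / 2) * (F (μ - 1) + F (μ + 1)) := ENNReal.tsum_le_tsum hterm
    _ = ENNReal.ofReal (r / 2) * (∑' μ, F μ + ∑' μ, F μ) := by
        have h1 : ∑' μ : ℤ, F (μ - 1) = ∑' μ, F μ := (Equiv.subRight (1 : ℤ)).tsum_eq F
        have h2 : ∑' μ : ℤ, F (μ + 1) = ∑' μ, F μ := (Equiv.addRight (1 : ℤ)).tsum_eq F
        rw [ENNReal.tsum_mul_left, ENNReal.tsum_add, h1, h2]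
    _ = ENNReal.ofReal r * weightedTail K m g := by
        rw [← two_mul, ← mul_assoc, ← ENNReal.ofReal_ofNat 2,
          ← ENNReal.ofReal_mul (by positivity), div_mul_cancel₀ r two_ne_zero]
        rfl

lemma exp_neg_int_mul_pi_eq (μ : ℤ) :
    Complex.exp (-Complex.I * (μ : ℂ) * ((-π : ℝ) : ℂ)) =
      Complex.exp (-Complex.I * (μ : ℂ) * ((π : ℝ) : ℂ)) := by
  rw [Complex.exp_eq_exp_iff_exists_int]
  exact ⟨μ, by push_cast; ring⟩

lemma continuous_comp_cos {f : ℝ → ℂ} (hf : ContinuousOn f (Set.Icc (-1 : ℝ) 1)) :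
    Continuous fun θ => f (Real.cos θ) :=
  hf.comp_continuous Real.continuous_cos Real.cos_mem_Icc

lemma two_mul_fourierCoef_comp_cos {f : ℝ → ℂ} (hf : DifferentiableOn ℝ f (Set.Icc (-1 : ℝ) 1))
    (hf' : ContinuousOn (derivWithin f (Set.Icc (-1 : ℝ) 1)) (Set.Icc (-1 : ℝ) 1)) (μ : ℤ) :
    2 * (μ : ℂ) * fourierCoef (fun θ => f (Real.cos θ)) μ =
      fourierCoef (fun θ => derivWithin f (Set.Icc (-1 : ℝ) 1) (Real.cos θ)) (μ - 1) -
        fourierCoef (fun θ => derivWithin f (Set.Icc (-1 : ℝ) 1) (Real.cos θ)) (μ + 1) := by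
  set g := derivWithin f (Set.Icc (-1 : ℝ) 1) with hg
  have hfc := continuous_comp_cos hf.continuousOn
  have hgc := continuous_comp_cos hf'
  have hi : ∀ {φ : ℝ → ℂ} (_ : Continuous φ) (ν : ℤ), IntervalIntegrable
      (fun θ : ℝ => φ θ * Complex.exp (-Complex.I * (ν : ℂ) * (θ : ℂ))) volume (-π) π :=
    fun hφ ν => Continuous.intervalIntegrable (by fun_prop) _ _
  have hderiv : ∀ θ : ℝ, HasDerivAt
      (fun θ : ℝ => f (Real.cos θ) * Complex.exp (-Complex.I * (μ : ℂ) * (θ : ℂ)))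
      (Complex.I / 2 * (g (Real.cos θ) * Complex.exp (-Complex.I * ((μ - 1 : ℤ) : ℂ) * (θ : ℂ)) -
        g (Real.cos θ) * Complex.exp (-Complex.I * ((μ + 1 : ℤ) : ℂ) * (θ : ℂ)) -
        2 * μ * (f (Real.cos θ) * Complex.exp (-Complex.I * (μ : ℂ) * (θ : ℂ))))) θ := by
    intro θ
    have h1 : HasDerivAt (fun θ => f (Real.cos θ)) ((-Real.sin θ) • g (Real.cos θ)) θ :=
      (hf _ (Real.cos_mem_Icc θ)).hasDerivWithinAt.scomp_hasDerivAt θ (Real.hasDerivAt_cos θ)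
        Real.cos_mem_Icc
    have h2 : HasDerivAt (fun θ : ℝ => Complex.exp (-Complex.I * (μ : ℂ) * (θ : ℂ)))
        (Complex.exp (-Complex.I * (μ : ℂ) * (θ : ℂ)) * (-Complex.I * (μ : ℂ))) θ := by
      have := ((Complex.ofRealCLM.hasDerivAt (x := θ)).const_mul (-Complex.I * (μ : ℂ))).cexp
      simpa using this
    refine (h1.mul h2).congr_deriv ?_
    have e1 : Complex.exp (-Complex.I * ((μ - 1 : ℤ) : ℂ) * (θ : ℂ)) =
        Complex.exp (-Complex.I * (μ : ℂ) * (θ : ℂ)) * Complex.exp (θ * Complex.I) := by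
      rw [← Complex.exp_add]; push_cast; ring_nf
    have e2 : Complex.exp (-Complex.I * ((μ + 1 : ℤ) : ℂ) * (θ : ℂ)) =
        Complex.exp (-Complex.I * (μ : ℂ) * (θ : ℂ)) * Complex.exp (-θ * Complex.I) := by
      rw [← Complex.exp_add]; push_cast; ring_nf
    rw [e1, e2, Complex.real_smul]
    push_cast
    rw [Complex.sin]
    ring
  have hint := intervalIntegral.integral_eq_sub_of_hasDerivAt (a := -π) (b := π)
    (fun θ _ => hderiv θ)
    ((((hi hgc (μ - 1)).sub (hi hgc (μ + 1))).sub ((hi hfc μ).const_mul _)).const_mul _)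
  rw [exp_neg_int_mul_pi_eq, Real.cos_neg, sub_self, intervalIntegral.integral_const_mul,
    intervalIntegral.integral_sub ((hi hgc (μ - 1)).sub (hi hgc (μ + 1)))
      ((hi hfc μ).const_mul _),
    intervalIntegral.integral_sub (hi hgc (μ - 1)) (hi hgc (μ + 1)),
    intervalIntegral.integral_const_mul] at hint
  have hz := (mul_eq_zero.mp hint).resolve_left
    (div_ne_zero Complex.I_ne_zero two_ne_zero)
  simp only [fourierCoef]
  linear_combination (-(1 / (2 * (π : ℂ)))) * hz

lemma weightedTail_comp_cos_le (m K : ℕ) (hmK : m ≤ K) (f : ℝ → ℂ)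
    (hf : ContDiffOn ℝ (m : ℕ∞) f (Set.Icc (-1 : ℝ) 1)) :
    weightedTail K m (fourierCoef fun θ => f (Real.cos θ)) ≤
      ENNReal.ofReal ((∏ i ∈ Finset.range m, (K : ℝ) / ((K : ℝ) - i)) ^ 2) *
        weightedTail (K - m) 0 (fourierCoef fun θ =>
          iteratedDerivWithin m f (Set.Icc (-1 : ℝ) 1) (Real.cos θ)) := by
  induction m generalizing K f with
  | zero => simp
  | succ m ih =>
    obtain ⟨K, rfl⟩ : ∃ k, K = k + 1 := ⟨K - 1, by omega⟩
    have hmK' : m ≤ K := by omega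
    have hu : UniqueDiffOn ℝ (Set.Icc (-1 : ℝ) 1) := uniqueDiffOn_Icc (by norm_num)
    have hd : ContDiffOn ℝ (m : ℕ∞) (derivWithin f (Set.Icc (-1 : ℝ) 1)) (Set.Icc (-1 : ℝ) 1) :=
      hf.derivWithin hu (by norm_cast)
    have hstep := weightedTail_succ_le hmK' (two_mul_fourierCoef_comp_cos
      (hf.differentiableOn (by simp)) hd.continuousOn)
    have hprod : ∏ i ∈ Finset.range (m + 1), ((K + 1 : ℕ) : ℝ) / (((K + 1 : ℕ) : ℝ) - i) =
        (((K : ℝ) + 1) / K) ^ m * ∏ i ∈ Finset.range m, (K : ℝ) / ((K : ℝ) - i) := by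
      rw [Finset.prod_range_succ']
      have h0 : ((K + 1 : ℕ) : ℝ) / (((K + 1 : ℕ) : ℝ) - (0 : ℕ)) = 1 := by
        rw [Nat.cast_zero, sub_zero, div_self (by positivity)]
      rw [h0, mul_one, ← Finset.card_range m, ← Finset.prod_const, Finset.card_range,
        ← Finset.prod_mul_distrib]
      refine Finset.prod_congr rfl fun i hi => ?_
      have hK : (K : ℝ) ≠ 0 := by
        have := Finset.mem_range.mp hi
        exact_mod_cast (by omega : K ≠ 0)
      rw [div_mul_div_cancel₀ hK]
      push_cast
      congr 1
      ring
    rw [iteratedDerivWithin_succ', hprod, Nat.add_sub_add_right, mul_pow, ← pow_mul, mul_comm m 2,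
      ENNReal.ofReal_mul (by positivity), mul_assoc]
    exact hstep.trans (mul_le_mul_right (ih K hmK' _ hd) _)

lemma fourierCoef_eq_fourierCoeffOn (φ : ℝ → ℂ) (μ : ℤ) :
    fourierCoef φ μ = fourierCoeffOn (neg_lt_self Real.pi_pos) φ μ := by
  rw [fourierCoeffOn_eq_integral, fourierCoef, Complex.real_smul]
  congr 1
  · push_cast; ring
  · refine intervalIntegral.integral_congr fun θ _ => ?_
    simp only [fourier_coe_apply, smul_eq_mul]
    rw [mul_comm]
    congr 2
    have : (π : ℂ) ≠ 0 := by exact_mod_cast Real.pi_ne_zero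
    push_cast
    field_simp
    ring

lemma summable_norm_fourierCoef_sq {φ : ℝ → ℂ} (hφ : Continuous φ) :
    Summable fun μ : ℤ => ‖fourierCoef φ μ‖ ^ 2 := by
  simp_rw [fourierCoef_eq_fourierCoeffOn]
  refine (hasSum_sq_fourierCoeffOn _ ?_).summable
  obtain ⟨C, hC⟩ := (isCompact_Icc (a := -π) (b := π)).exists_bound_of_continuousOn
    hφ.continuousOn
  exact MemLp.of_bound hφ.aestronglyMeasurable C <|
    (ae_restrict_mem measurableSet_Ioc).mono fun θ hθ => hC θ (Set.Ioc_subset_Icc_self hθ)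

lemma fourierCoef_exp (ν μ : ℤ) :
    fourierCoef (fun θ => Complex.exp (Complex.I * (ν : ℂ) * (θ : ℂ))) μ =
      if ν = μ then 1 else 0 := by
  have hπ : (π : ℂ) ≠ 0 := by exact_mod_cast Real.pi_ne_zero
  have hcongr : ∀ θ : ℝ, Complex.exp (Complex.I * (ν : ℂ) * (θ : ℂ)) *
      Complex.exp (-Complex.I * (μ : ℂ) * (θ : ℂ)) =
      Complex.exp (-Complex.I * ((μ - ν : ℤ) : ℂ) * (θ : ℂ)) := by
    intro θ
    rw [← Complex.exp_add]
    push_cast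
    ring_nf
  simp only [fourierCoef, hcongr]
  split_ifs with h
  · subst h
    simp only [sub_self, Int.cast_zero, mul_zero, zero_mul, Complex.exp_zero,
      intervalIntegral.integral_const, Complex.real_smul]
    push_cast
    field_simp
    ring
  · have hne : -Complex.I * ((μ - ν : ℤ) : ℂ) ≠ 0 :=
      mul_ne_zero (neg_ne_zero.mpr Complex.I_ne_zero)
        (Int.cast_ne_zero.mpr (sub_ne_zero.mpr (Ne.symm h)))
    rw [integral_exp_mul_complex hne, exp_neg_int_mul_pi_eq, sub_self, zero_div, mul_zero]

lemma fourierCoef_truncFourier (N : ℕ) (φ : ℝ → ℂ) (μ : ℤ) :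
    fourierCoef (truncFourier N φ) μ = if |μ| ≤ (N : ℤ) then fourierCoef φ μ else 0 := by
  have : fourierCoef (truncFourier N φ) μ = ∑ ν ∈ Finset.Icc (-(N : ℤ)) (N : ℤ),
      fourierCoef φ ν *
        fourierCoef (fun θ => Complex.exp (Complex.I * (ν : ℂ) * (θ : ℂ))) μ := by
    conv_lhs => unfold fourierCoef
    simp only [truncFourier, Finset.sum_mul]
    rw [intervalIntegral.integral_finsetSum
      fun ν _ => Continuous.intervalIntegrable (by fun_prop) _ _, Finset.mul_sum]
    refine Finset.sum_congr rfl fun ν _ => ?_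
    simp only [mul_assoc, intervalIntegral.integral_const_mul]
    simp only [fourierCoef, mul_assoc]
    ring
  rw [this]
  simp only [fourierCoef_exp, mul_ite, mul_one, mul_zero, Finset.sum_ite_eq', Finset.mem_Icc,
    abs_le]

lemma fourierCoef_sub_truncFourier (N : ℕ) {φ : ℝ → ℂ} (hφ : Continuous φ) (μ : ℤ) :
    fourierCoef (fun θ => φ θ - truncFourier N φ θ) μ =
      if ((N + 1 : ℕ) : ℤ) ≤ |μ| then fourierCoef φ μ else 0 := by
  have hT : Continuous (truncFourier N φ) := by
    unfold truncFourier
    fun_prop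
  have : fourierCoef (fun θ => φ θ - truncFourier N φ θ) μ =
      fourierCoef φ μ - fourierCoef (truncFourier N φ) μ := by
    simp only [fourierCoef, sub_mul]
    rw [intervalIntegral.integral_sub (Continuous.intervalIntegrable (by fun_prop) _ _)
      (Continuous.intervalIntegrable (by fun_prop) _ _), mul_sub]
  rw [this, fourierCoef_truncFourier]
  grind

lemma sobolevNorm_zero_sq {φ : ℝ → ℂ} (hφ : Continuous φ) :
    sobolevNorm 0 φ ^ 2 = ∑' μ : ℤ, ‖fourierCoef φ μ‖ ^ 2 := by
  have h := (summable_norm_fourierCoef_sq hφ).tsum_subtype_add_tsum_subtype_compl {0}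
  rw [tsum_singleton (0 : ℤ) fun μ => ‖fourierCoef φ μ‖ ^ 2] at h
  rw [sobolevNorm, Real.sq_sqrt (by positivity), ← h]
  simp only [mul_zero, pow_zero, one_mul]
  rfl

lemma sobolevNorm_sub_truncFourier_sq_le (N m : ℕ) {φ : ℝ → ℂ} (hφ : Continuous φ)
    (hfin : weightedTail (N + 1) m (fourierCoef φ) ≠ ∞) :
    sobolevNorm m (fun θ => φ θ - truncFourier N φ θ) ^ 2 ≤
      (weightedTail (N + 1) m (fourierCoef φ)).toReal := by
  rw [sobolevNorm, Real.sq_sqrt (by positivity)]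
  simp only [fourierCoef_sub_truncFourier N hφ]
  rw [if_neg (by simp), norm_zero, zero_pow two_ne_zero, zero_add]
  have h : ∀ μ : ℤ, |(μ : ℝ)| ^ (2 * m) *
      ‖if ((N + 1 : ℕ) : ℤ) ≤ |μ| then fourierCoef φ μ else 0‖ ^ 2 =
      (if ((N + 1 : ℕ) : ℤ) ≤ |μ| then
        ENNReal.ofReal (|(μ : ℝ)| ^ (2 * m) * ‖fourierCoef φ μ‖ ^ 2) else 0).toReal := by
    intro μ
    split_ifs
    · rw [ENNReal.toReal_ofReal (by positivity)]
    · simp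
  simp only [h]
  rw [← ENNReal.tsum_toReal_eq fun μ => by
    split_ifs
    exacts [ENNReal.ofReal_ne_top, ENNReal.zero_ne_top]]
  exact ENNReal.toReal_mono hfin
    (ENNReal.tsum_comp_le_tsum_of_injective Subtype.val_injective _)

lemma sigmaConst_eq_prod_range (m N : ℕ) :
    sigmaConst m N =
      ∏ i ∈ Finset.range m, ((N + 1 : ℕ) : ℝ) / (((N + 1 : ℕ) : ℝ) - i) := by
  rcases m with _ | m
  · simp [sigmaConst]
  · rw [sigmaConst, Finset.prod_range_succ', Nat.add_sub_cancel, Nat.cast_zero, sub_zero,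
      div_self (by positivity), mul_one, Finset.range_eq_Ico, Finset.prod_Ico_add'
        (fun i : ℕ => ((N + 1 : ℕ) : ℝ) / (((N + 1 : ℕ) : ℝ) - i))]
    push_cast
    rfl

lemma sigmaConst_nonneg {m N : ℕ} (hm : m ≤ N + 1) : 0 ≤ sigmaConst m N := by
  rw [sigmaConst_eq_prod_range]
  refine Finset.prod_nonneg fun i hi => div_nonneg (Nat.cast_nonneg _) (sub_nonneg.mpr ?_)
  have := Finset.mem_range.mp hi
  exact_mod_cast (by omega : i ≤ N + 1)

/-- For integers `N ≥ 1`, `0 ≤ m ≤ N+1` and `f ∈ C^m[-1,1]`, with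
`f_c(θ) = f(cos θ)`, one has `‖(I − S_N) f_c‖_{H^m} ≤ σ_{m,N} ‖(f^{(m)})_c‖_{H^0}`. -/
theorem truncated_fourier_estimate (N m : ℕ) (hN : 1 ≤ N) (hm : m ≤ N + 1)
    (f : ℝ → ℂ) (hf : ContDiffOn ℝ (m : ℕ∞) f (Set.Icc (-1 : ℝ) 1)) :
    sobolevNorm m
        (fun θ => f (Real.cos θ) - truncFourier N (fun t => f (Real.cos t)) θ) ≤
      sigmaConst m N *
        sobolevNorm 0
          (fun θ => iteratedDerivWithin m f (Set.Icc (-1 : ℝ) 1) (Real.cos θ)) := by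
  have hu : UniqueDiffOn ℝ (Set.Icc (-1 : ℝ) 1) := uniqueDiffOn_Icc (by norm_num)
  have hfc := continuous_comp_cos hf.continuousOn
  have hgc := continuous_comp_cos (hf.continuousOn_iteratedDerivWithin (m := m) le_rfl hu)
  set g : ℝ → ℂ := fun θ => iteratedDerivWithin m f (Set.Icc (-1 : ℝ) 1) (Real.cos θ)
  have htail : weightedTail (N + 1) m (fourierCoef fun θ => f (Real.cos θ)) ≤
      ENNReal.ofReal ((sigmaConst m N * sobolevNorm 0 g) ^ 2) := by
    refine (weightedTail_comp_cos_le m (N + 1) hm f hf).trans ?_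
    rw [← sigmaConst_eq_prod_range, mul_pow, ENNReal.ofReal_mul (by positivity),
      sobolevNorm_zero_sq hgc, ENNReal.ofReal_tsum_of_nonneg (fun _ => by positivity)
        (summable_norm_fourierCoef_sq hgc)]
    exact mul_le_mul_right (weightedTail_zero_le _ _) _
  have hsq := sobolevNorm_sub_truncFourier_sq_le N m hfc (ne_top_of_le_ne_top ofReal_ne_top htail)
  exact (sq_le_sq₀ (Real.sqrt_nonneg _)
    (mul_nonneg (sigmaConst_nonneg hm) (Real.sqrt_nonneg _))).mp
      (hsq.trans (ENNReal.toReal_le_of_le_ofReal (sq_nonneg _) htail))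
end

section
/- Let r ∈ [0,2] and let N ≥ 1 be an integer. There exists a constant c_N > 0 (independent of a, b, k and f) such that for all real a < b with h := (b−a)/2, all k with hk ≥ 1, and all f ∈ C^{N+1}[a,b], the FCC rule on [a,b] satisfies |I_k^{[a,b]}(f) − I_{k,N}^{[a,b]}(f)| ≤ c_N (1/k)^r h^{N+2−r} max_{x∈[a,b]} |f^{(N+1)}(x)|. -/
open scoped Real

/-- The Clenshaw–Curtis points `t_{j,N} = cos(jπ/N)`. -/
noncomputable def fccNode (N j : ℕ) : ℝ := Real.cos ((j : ℝ) * Real.pi / (N : ℝ))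

/-- The polynomial of degree ≤ N interpolating `f` at the Clenshaw–Curtis points. -/
noncomputable def fccInterp (N : ℕ) (f : ℝ → ℂ) : Polynomial ℂ :=
  Lagrange.interpolate (Finset.range (N + 1)) (fun j => ((fccNode N j : ℝ) : ℂ))
    (fun j => f (fccNode N j))

/-- The Filon–Clenshaw–Curtis rule `I_{k,N}(f)` on `[-1,1]`. -/
noncomputable def IkN (k : ℝ) (N : ℕ) (f : ℝ → ℂ) : ℂ :=
  if (1 : ℝ) / 2 ≤ k then
    ∫ x in (-1 : ℝ)..1, (fccInterp N f).eval (x : ℂ) * Complex.exp (Complex.I * k * x)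
  else
    ∫ x in (-1 : ℝ)..1,
      (fccInterp N (fun t => f t * Complex.exp (Complex.I * k * t))).eval (x : ℂ)

/-- `I_k^{[a,b]}(f) = ∫_a^b f(x) exp(ikx) dx`. -/
noncomputable def Ikab (k a b : ℝ) (f : ℝ → ℂ) : ℂ :=
  ∫ x in a..b, f x * Complex.exp (Complex.I * k * x)

/-- The FCC rule on `[a,b]`: `I_{k,N}^{[a,b]}(f) = h exp(ikc) I_{hk,N}(f̃)` with
`c = (a+b)/2`, `h = (b−a)/2`, `f̃(t) = f(c+ht)`. -/
noncomputable def IkNab (k : ℝ) (N : ℕ) (a b : ℝ) (f : ℝ → ℂ) : ℂ :=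
  (((b - a) / 2 : ℝ) : ℂ) * Complex.exp (Complex.I * k * (((a + b) / 2 : ℝ) : ℂ)) *
    IkN ((b - a) / 2 * k) N (fun t => f ((a + b) / 2 + (b - a) / 2 * t))

open Polynomial in
theorem Polynomial.exists_derivative_eq_of_degree_lt {F : Type*} [Field F] [CharZero F]
    (P : F[X]) (n : ℕ) (hP : P.degree < n) :
    ∃ Q : F[X], Q.degree < (n + 1 : ℕ) ∧ derivative Q = P := by
  refine ⟨∑ i ∈ Finset.range n, monomial (i + 1) (P.coeff i / ((i : F) + 1)), ?_, ?_⟩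
  · refine (degree_sum_le _ _).trans_lt ((Finset.sup_lt_iff (WithBot.bot_lt_coe _)).2 ?_)
    intro i hi
    refine (degree_monomial_le _ _).trans_lt ?_
    have := Finset.mem_range.1 hi
    exact_mod_cast Nat.add_lt_add_right this 1
  · have hmon : ∀ i : ℕ, derivative (monomial (i + 1) (P.coeff i / ((i : F) + 1))) =
        monomial i (P.coeff i) := fun i => by
      have : (i : F) + 1 ≠ 0 := by exact_mod_cast i.succ_ne_zero
      rw [derivative_monomial]
      congr 1
      push_cast
      field_simp
    ext m
    simp only [derivative_sum, hmon, finsetSum_coeff, coeff_monomial, Finset.sum_ite_eq',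
      Finset.mem_range]
    split_ifs with h
    · rfl
    · exact (coeff_eq_zero_of_degree_lt
        (hP.trans_le (by exact_mod_cast not_lt.1 h))).symm

/-- A function with `n` derivatives, the last bounded by `M`, is approximated together with its
derivatives by a polynomial of degree less than `n`. -/
theorem exists_polynomial_approx_derivatives {M : ℝ} (n : ℕ) (G : ℕ → ℝ → ℂ)
    (hG : ∀ j < n, ∀ x ∈ Set.Icc (-1 : ℝ) 1,
      HasDerivWithinAt (G j) (G (j + 1) x) (Set.Icc (-1) 1) x)
    (hM : ∀ x ∈ Set.Icc (-1 : ℝ) 1, ‖G n x‖ ≤ M) :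
    ∃ P : Polynomial ℂ, P.degree < n ∧ ∀ j ≤ n, ∀ x ∈ Set.Icc (-1 : ℝ) 1,
      ‖G j x - (Polynomial.derivative^[j] P).eval (x : ℂ)‖ ≤ 2 ^ n * M := by
  have hM0 : 0 ≤ M := (norm_nonneg _).trans (hM 0 (by simp))
  induction n generalizing G with
  | zero =>
    refine ⟨0, by simp, fun j hj x hx => ?_⟩
    obtain rfl : j = 0 := by omega
    simpa using hM x hx
  | succ n ih =>
    obtain ⟨P, hPdeg, hP⟩ := ih (fun j => G (j + 1))
      (fun j hj x hx => hG (j + 1) (by omega) x hx) hM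
    obtain ⟨Q, hQdeg, hQ⟩ := P.exists_derivative_eq_of_degree_lt n hPdeg
    set c : ℂ := G 0 (-1) - Q.eval (-1 : ℂ) with hc
    have hd : Polynomial.derivative (Q + Polynomial.C c) = P := by simp [hQ]
    have hmono : (2 : ℝ) ^ n * M ≤ 2 ^ (n + 1) * M := by
      rw [pow_succ]; nlinarith [mul_nonneg (pow_nonneg (zero_le_two (α := ℝ)) n) hM0]
    refine ⟨Q + Polynomial.C c, ?_, fun j hj x hx => ?_⟩
    · refine (Polynomial.degree_add_le _ _).trans_lt (max_lt hQdeg ?_)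
      refine Polynomial.degree_C_le.trans_lt ?_
      exact_mod_cast n.succ_pos
    · cases j with
      | succ j =>
        rw [Function.iterate_succ_apply, hd]
        exact (hP j (by omega) x hx).trans hmono
      | zero =>
        have hderiv : ∀ y ∈ Set.Icc (-1 : ℝ) 1,
            HasDerivWithinAt (fun y : ℝ => G 0 y - (Q + Polynomial.C c).eval (y : ℂ))
              (G 1 y - P.eval (y : ℂ)) (Set.Icc (-1) 1) y := fun y hy => by
          have h := ((Q + Polynomial.C c).hasDerivAt (y : ℂ)).comp_ofReal
          rw [hd] at h
          exact (hG 0 (by omega) y hy).sub h.hasDerivWithinAt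
        have hmem : (-1 : ℝ) ∈ Set.Icc (-1 : ℝ) 1 := by simp
        have := (convex_Icc (-1 : ℝ) 1).norm_image_sub_le_of_norm_hasDerivWithin_le hderiv
          (fun y hy => by simpa using hP 0 (by omega) y hy) hmem hx
        have h0 : G 0 (-1) - (Q + Polynomial.C c).eval (((-1 : ℝ)) : ℂ) = 0 := by
          simp [hc]
        rw [h0, sub_zero] at this
        have hx2 : ‖x - -1‖ ≤ 2 := by
          rw [Real.norm_eq_abs, abs_le]; constructor <;> linarith [hx.1, hx.2]
        calc _ ≤ 2 ^ n * M * ‖x - -1‖ := this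
          _ ≤ 2 ^ n * M * 2 := by gcongr
          _ = _ := by ring

theorem norm_integral_mul_exp_le {e₀ e₁ e₂ : ℝ → ℂ} {B K : ℝ} (hK : 0 < K)
    (h₀ : ∀ x ∈ Set.Icc (-1 : ℝ) 1, HasDerivWithinAt e₀ (e₁ x) (Set.Icc (-1) 1) x)
    (h₁ : ∀ x ∈ Set.Icc (-1 : ℝ) 1, HasDerivWithinAt e₁ (e₂ x) (Set.Icc (-1) 1) x)
    (hc : ContinuousOn e₂ (Set.Icc (-1) 1))
    (hl : e₀ (-1) = 0) (hr : e₀ 1 = 0)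
    (hB₁ : ∀ x ∈ Set.Icc (-1 : ℝ) 1, ‖e₁ x‖ ≤ B)
    (hB₂ : ∀ x ∈ Set.Icc (-1 : ℝ) 1, ‖e₂ x‖ ≤ B) :
    ‖∫ x in (-1 : ℝ)..1, e₀ x * Complex.exp (Complex.I * K * x)‖ ≤ 4 * B / K ^ 2 := by
  have hu : Set.uIcc (-1 : ℝ) 1 = Set.Icc (-1) 1 := Set.uIcc_of_le (by norm_num)
  have hKc : Complex.I * (K : ℂ) ≠ 0 :=
    mul_ne_zero Complex.I_ne_zero (by exact_mod_cast hK.ne')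
  set v : ℝ → ℂ := fun x => Complex.exp (Complex.I * K * x) / (Complex.I * K) with hv
  have hvd : ∀ x : ℝ, HasDerivAt v (Complex.exp (Complex.I * K * x)) x := fun x => by
    have h : HasDerivAt (fun z : ℂ => Complex.exp (Complex.I * K * z) / (Complex.I * K))
        (Complex.exp (Complex.I * K * x)) (x : ℂ) := by
      have := (((hasDerivAt_id (x : ℂ)).const_mul (Complex.I * K)).cexp).div_const
        (Complex.I * K)
      simpa [hKc] using this
    exact h.comp_ofReal
  have hexp : ∀ x : ℝ, ‖Complex.exp (Complex.I * K * x)‖ = 1 := fun x => by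
    rw [show Complex.I * (K : ℂ) * x = ((K * x : ℝ) : ℂ) * Complex.I by push_cast; ring]
    exact Complex.norm_exp_ofReal_mul_I _
  have hvn : ∀ x, ‖v x‖ = 1 / K := fun x => by
    simp [hv, hexp, abs_of_pos hK]
  have hvi : IntervalIntegrable (fun x : ℝ => Complex.exp (Complex.I * K * x))
      MeasureTheory.volume (-1) 1 := (by fun_prop : Continuous _).intervalIntegrable _ _
  have hc₁ : ContinuousOn e₁ (Set.Icc (-1) 1) := fun x hx => (h₁ x hx).continuousWithinAt
  have hi₁ : IntervalIntegrable e₁ MeasureTheory.volume (-1) 1 :=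
    (hu ▸ hc₁ : ContinuousOn e₁ (Set.uIcc (-1) 1)).intervalIntegrable
  have hi₂ : IntervalIntegrable e₂ MeasureTheory.volume (-1) 1 :=
    (hu ▸ hc : ContinuousOn e₂ (Set.uIcc (-1) 1)).intervalIntegrable
  have ibp₀ := intervalIntegral.integral_mul_deriv_eq_deriv_mul_of_hasDerivWithinAt
    (u := e₀) (v := v) (hu.symm ▸ h₀) (fun x _ => (hvd x).hasDerivWithinAt) hi₁ hvi
  have ibp₁ := intervalIntegral.integral_mul_deriv_eq_deriv_mul_of_hasDerivWithinAt
    (u := e₁) (v := v) (hu.symm ▸ h₁) (fun x _ => (hvd x).hasDerivWithinAt) hi₂ hvi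
  have hfac : ∫ x in (-1 : ℝ)..1, e₁ x * v x =
      (∫ x in (-1 : ℝ)..1, e₁ x * Complex.exp (Complex.I * K * x)) / (Complex.I * K) := by
    rw [← intervalIntegral.integral_div]
    exact intervalIntegral.integral_congr fun x _ => (mul_div_assoc _ _ _).symm
  have hB : 0 ≤ B := (norm_nonneg _).trans (hB₁ 0 (by simp))
  have hrem : ‖∫ x in (-1 : ℝ)..1, e₂ x * v x‖ ≤ B * (1 / K) * |1 - (-1 : ℝ)| := by
    refine intervalIntegral.norm_integral_le_of_norm_le_const fun x hx => ?_
    have hx' : x ∈ Set.Icc (-1 : ℝ) 1 := hu ▸ Set.uIoc_subset_uIcc hx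
    rw [norm_mul, hvn]
    gcongr
    exact hB₂ x hx'
  have hbd : ∀ x ∈ Set.Icc (-1 : ℝ) 1, ‖e₁ x * v x‖ ≤ B * (1 / K) := fun x hx => by
    rw [norm_mul, hvn]
    gcongr
    exact hB₁ x hx
  have hintegral : ‖∫ x in (-1 : ℝ)..1, e₁ x * Complex.exp (Complex.I * K * x)‖ ≤ 4 * B / K := by
    rw [ibp₁]
    calc _ ≤ ‖e₁ 1 * v 1‖ + ‖e₁ (-1) * v (-1)‖ + ‖∫ x in (-1 : ℝ)..1, e₂ x * v x‖ :=
          (norm_sub_le _ _).trans (by gcongr; exact norm_sub_le _ _)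
      _ ≤ B * (1 / K) + B * (1 / K) + B * (1 / K) * |1 - (-1 : ℝ)| := by
          gcongr
          · exact hbd 1 (by simp)
          · exact hbd (-1) (by simp)
      _ = 4 * B / K := by norm_num; ring
  rw [ibp₀, hl, hr, hfac]
  simp only [zero_mul, sub_zero, zero_sub, norm_neg, norm_div, norm_mul, Complex.norm_I, one_mul,
    Complex.norm_real, Real.norm_eq_abs, abs_of_pos hK]
  calc _ ≤ 4 * B / K / K := by gcongr
    _ = _ := by rw [div_div, sq]

theorem fccNode_injOn {N : ℕ} (hN : 1 ≤ N) :
    Set.InjOn (fun j => ((fccNode N j : ℝ) : ℂ)) (Finset.range (N + 1) : Set ℕ) := by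
  have hN' : (0 : ℝ) < N := by exact_mod_cast hN
  have hmem : ∀ i ∈ (Finset.range (N + 1) : Set ℕ),
      (i : ℝ) * Real.pi / N ∈ Set.Icc 0 Real.pi := fun i hi => by
    have hi' : (i : ℝ) ≤ N := by
      have := Finset.mem_range.1 (Finset.mem_coe.1 hi)
      exact_mod_cast Nat.le_of_lt_succ this
    refine ⟨by positivity, ?_⟩
    rw [div_le_iff₀ hN', mul_comm]
    gcongr
  intro i hi j hj hij
  have h := Real.injOn_cos (hmem i hi) (hmem j hj) (Complex.ofReal_injective hij)
  have hpi := Real.pi_pos.ne'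
  field_simp at h
  exact_mod_cast h

theorem fccNode_mem_Icc (N j : ℕ) : fccNode N j ∈ Set.Icc (-1 : ℝ) 1 := Real.cos_mem_Icc _

theorem fccInterp_eval_node {N : ℕ} (hN : 1 ≤ N) (g : ℝ → ℂ) {j : ℕ} (hj : j ≤ N) :
    (fccInterp N g).eval ((fccNode N j : ℝ) : ℂ) = g (fccNode N j) :=
  Lagrange.eval_interpolate_at_node (fun j => g (fccNode N j)) (fccNode_injOn hN)
    (Finset.mem_range.2 (Nat.lt_succ_of_le hj))

theorem fccInterp_eval_one {N : ℕ} (hN : 1 ≤ N) (g : ℝ → ℂ) :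
    (fccInterp N g).eval 1 = g 1 := by
  have h := fccInterp_eval_node hN g (Nat.zero_le N)
  simpa [fccNode] using h

theorem fccInterp_eval_neg_one {N : ℕ} (hN : 1 ≤ N) (g : ℝ → ℂ) :
    (fccInterp N g).eval (-1) = g (-1) := by
  have h := fccInterp_eval_node hN g le_rfl
  have h0 : (N : ℝ) ≠ 0 := by positivity
  have hn : fccNode N N = -1 := by
    rw [fccNode, mul_div_cancel_left₀ _ h0, Real.cos_pi]
  simpa [hn] using h

/-- The interpolation operator and its derivatives are bounded in the supremum norm. -/
theorem exists_bound_derivative_fccInterp (N m : ℕ) :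
    ∃ B : ℝ, 0 ≤ B ∧ ∀ (g : ℝ → ℂ) (M : ℝ), (∀ x ∈ Set.Icc (-1 : ℝ) 1, ‖g x‖ ≤ M) →
      ∀ x ∈ Set.Icc (-1 : ℝ) 1,
        ‖(Polynomial.derivative^[m] (fccInterp N g)).eval (x : ℂ)‖ ≤ B * M := by
  set L : ℕ → Polynomial ℂ := fun j =>
    Lagrange.basis (Finset.range (N + 1)) (fun j => ((fccNode N j : ℝ) : ℂ)) j
  have hb : ∀ j, ∃ b : ℝ, ∀ x ∈ Set.Icc (-1 : ℝ) 1,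
      ‖(Polynomial.derivative^[m] (L j)).eval (x : ℂ)‖ ≤ b := fun j =>
    isCompact_Icc.exists_bound_of_continuousOn
      ((Polynomial.continuous _).comp Complex.continuous_ofReal).continuousOn
  choose b hb using hb
  have hb0 : ∀ j, 0 ≤ b j := fun j => (norm_nonneg _).trans (hb j 0 (by simp))
  refine ⟨∑ j ∈ Finset.range (N + 1), b j, Finset.sum_nonneg fun j _ => hb0 j,
    fun g M hg x hx => ?_⟩
  rw [fccInterp, Lagrange.interpolate_apply, Polynomial.iterate_derivative_sum,
    Polynomial.eval_finsetSum, Finset.sum_mul]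
  refine norm_sum_le_of_le _ fun j _ => ?_
  rw [Polynomial.iterate_derivative_C_mul, Polynomial.eval_mul, Polynomial.eval_C, norm_mul,
    mul_comm]
  exact mul_le_mul (hb j x hx) (hg _ (fccNode_mem_Icc N j)) (norm_nonneg _) (hb0 j)

theorem fccInterp_sub_polynomial {N : ℕ} (hN : 1 ≤ N) (g : ℝ → ℂ) (P : Polynomial ℂ)
    (hP : P.degree < (N + 1 : ℕ)) :
    fccInterp N (fun t => g t - P.eval (t : ℂ)) = fccInterp N g - P := by
  have h := Lagrange.eq_interpolate (f := P) (fccNode_injOn hN) (by simpa using hP)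
  conv_rhs => rw [h]
  rw [fccInterp, fccInterp, ← map_sub]
  rfl

/-- Derivatives of the interpolation error are controlled by the derivative of order `N + 1`. -/
theorem exists_bound_derivative_fccInterp_error {N : ℕ} (hN : 1 ≤ N) (m : ℕ) (hm : m ≤ N + 1) :
    ∃ B : ℝ, 0 ≤ B ∧ ∀ (G : ℕ → ℝ → ℂ) (M : ℝ),
      (∀ j < N + 1, ∀ x ∈ Set.Icc (-1 : ℝ) 1,
        HasDerivWithinAt (G j) (G (j + 1) x) (Set.Icc (-1) 1) x) →
      (∀ x ∈ Set.Icc (-1 : ℝ) 1, ‖G (N + 1) x‖ ≤ M) →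
      ∀ x ∈ Set.Icc (-1 : ℝ) 1,
        ‖G m x - (Polynomial.derivative^[m] (fccInterp N (G 0))).eval (x : ℂ)‖ ≤ B * M := by
  obtain ⟨B, hB0, hB⟩ := exists_bound_derivative_fccInterp N m
  refine ⟨2 ^ (N + 1) + B * 2 ^ (N + 1), by positivity, fun G M hG hM x hx => ?_⟩
  obtain ⟨P, hPdeg, hP⟩ := exists_polynomial_approx_derivatives (N + 1) G hG hM
  have hQ := hB (fun t => G 0 t - P.eval (t : ℂ)) (2 ^ (N + 1) * M)
    (fun y hy => by simpa using hP 0 (by omega) y hy) x hx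
  rw [fccInterp_sub_polynomial hN _ P hPdeg, Polynomial.iterate_derivative_sub,
    Polynomial.eval_sub] at hQ
  calc _ = ‖(G m x - (Polynomial.derivative^[m] P).eval (x : ℂ)) -
        ((Polynomial.derivative^[m] (fccInterp N (G 0))).eval (x : ℂ) -
          (Polynomial.derivative^[m] P).eval (x : ℂ))‖ := by congr 1; ring
    _ ≤ 2 ^ (N + 1) * M + B * (2 ^ (N + 1) * M) :=
        (norm_sub_le _ _).trans (add_le_add (hP m hm x hx) hQ)
    _ = _ := by ring

/-- The error of the rule on `[-1,1]` decays quadratically in the frequency. -/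
theorem exists_bound_IkN_error {N : ℕ} (hN : 1 ≤ N) :
    ∃ B : ℝ, 0 ≤ B ∧ ∀ (G : ℕ → ℝ → ℂ) (M K : ℝ), 1 ≤ K →
      (∀ j < N + 1, ∀ x ∈ Set.Icc (-1 : ℝ) 1,
        HasDerivWithinAt (G j) (G (j + 1) x) (Set.Icc (-1) 1) x) →
      ContinuousOn (G (N + 1)) (Set.Icc (-1) 1) →
      (∀ x ∈ Set.Icc (-1 : ℝ) 1, ‖G (N + 1) x‖ ≤ M) →
      ‖(∫ x in (-1 : ℝ)..1, G 0 x * Complex.exp (Complex.I * K * x)) - IkN K N (G 0)‖ ≤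
        B * M / K ^ 2 := by
  obtain ⟨B₁, hB₁0, hB₁⟩ := exists_bound_derivative_fccInterp_error hN 1 (by omega)
  obtain ⟨B₂, hB₂0, hB₂⟩ := exists_bound_derivative_fccInterp_error hN 2 (by omega)
  refine ⟨4 * (B₁ + B₂), by positivity, fun G M K hK hG hGc hM => ?_⟩
  have hM0 : 0 ≤ M := (norm_nonneg _).trans (hM 0 (by simp))
  have hu : Set.uIcc (-1 : ℝ) 1 = Set.Icc (-1) 1 := Set.uIcc_of_le (by norm_num)
  have hcont : ∀ j ≤ N + 1, ContinuousOn (G j) (Set.Icc (-1) 1) := fun j hj => by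
    rcases hj.lt_or_eq with hj | rfl
    · exact fun x hx => (hG j hj x hx).continuousWithinAt
    · exact hGc
  set e : ℕ → ℝ → ℂ := fun j x =>
    G j x - (Polynomial.derivative^[j] (fccInterp N (G 0))).eval (x : ℂ) with he
  have hed : ∀ j < N + 1, ∀ x ∈ Set.Icc (-1 : ℝ) 1,
      HasDerivWithinAt (e j) (e (j + 1) x) (Set.Icc (-1) 1) x := fun j hj x hx => by
    have h := ((Polynomial.derivative^[j] (fccInterp N (G 0))).hasDerivAt (x : ℂ)).comp_ofReal
    rw [← Function.iterate_succ_apply' Polynomial.derivative] at h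
    exact (hG j hj x hx).sub h.hasDerivWithinAt
  have hec : ContinuousOn (e 2) (Set.Icc (-1) 1) :=
    (hcont 2 (by omega)).sub
      ((Polynomial.continuous _).comp Complex.continuous_ofReal).continuousOn
  have key := norm_integral_mul_exp_le (B := (B₁ + B₂) * M) (zero_lt_one.trans_le hK)
    (hed 0 (by omega)) (hed 1 (by omega)) hec
    (by simp [he, fccInterp_eval_neg_one hN]) (by simp [he, fccInterp_eval_one hN])
    (fun x hx => (hB₁ G M hG hM x hx).trans (by gcongr; linarith))
    (fun x hx => (hB₂ G M hG hM x hx).trans (by gcongr; linarith))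
  have hexp : Continuous fun x : ℝ => Complex.exp (Complex.I * K * x) := by fun_prop
  rw [IkN, if_pos (by linarith), ← intervalIntegral.integral_sub]
  · calc _ = ‖∫ x in (-1 : ℝ)..1, e 0 x * Complex.exp (Complex.I * K * x)‖ := by
          congr 1
          exact intervalIntegral.integral_congr fun x _ => (sub_mul _ _ _).symm
      _ ≤ _ := key
      _ = _ := by ring
  · refine ContinuousOn.intervalIntegrable ?_
    rw [hu]
    exact (hcont 0 (by omega)).mul hexp.continuousOn
  · exact Continuous.intervalIntegrable
      (((Polynomial.continuous _).comp Complex.continuous_ofReal).mul hexp) _ _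

theorem Ikab_eq_integral_unit (k a b : ℝ) (f : ℝ → ℂ) :
    Ikab k a b f = (((b - a) / 2 : ℝ) : ℂ) *
      Complex.exp (Complex.I * k * (((a + b) / 2 : ℝ) : ℂ)) *
        ∫ t in (-1 : ℝ)..1, f ((a + b) / 2 + (b - a) / 2 * t) *
          Complex.exp (Complex.I * (((b - a) / 2 * k : ℝ) : ℂ) * t) := by
  have h := intervalIntegral.smul_integral_comp_add_mul (a := -1) (b := 1)
    (fun x : ℝ => f x * Complex.exp (Complex.I * k * x)) ((b - a) / 2) ((a + b) / 2)
  rw [show (a + b) / 2 + (b - a) / 2 * -1 = a by ring,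
    show (a + b) / 2 + (b - a) / 2 * 1 = b by ring] at h
  rw [Ikab, ← h, Complex.real_smul, mul_assoc,
    ← intervalIntegral.integral_const_mul (Complex.exp _)]
  refine congrArg _ (intervalIntegral.integral_congr fun t _ => ?_)
  rw [mul_left_comm, ← Complex.exp_add]
  congr 2
  push_cast
  ring

theorem hasDerivWithinAt_iteratedDerivWithin_rescale {a b : ℝ} (hab : a < b) {n : ℕ} {f : ℝ → ℂ}
    (hf : ContDiffOn ℝ (n : ℕ∞) f (Set.Icc a b)) {j : ℕ} (hj : j < n) {t : ℝ}
    (ht : t ∈ Set.Icc (-1 : ℝ) 1) :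
    HasDerivWithinAt (fun t : ℝ => ((b - a) / 2) ^ j •
        iteratedDerivWithin j f (Set.Icc a b) ((a + b) / 2 + (b - a) / 2 * t))
      (((b - a) / 2) ^ (j + 1) •
        iteratedDerivWithin (j + 1) f (Set.Icc a b) ((a + b) / 2 + (b - a) / 2 * t))
      (Set.Icc (-1) 1) t := by
  have hmaps : Set.MapsTo (fun t : ℝ => (a + b) / 2 + (b - a) / 2 * t)
      (Set.Icc (-1) 1) (Set.Icc a b) := fun t ht => by
    constructor <;> nlinarith [ht.1, ht.2]
  have hd : DifferentiableOn ℝ (iteratedDerivWithin j f (Set.Icc a b)) (Set.Icc a b) :=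
    hf.differentiableOn_iteratedDerivWithin (by exact_mod_cast hj) (uniqueDiffOn_Icc hab)
  have h := (hd ((a + b) / 2 + (b - a) / 2 * t) (hmaps ht)).hasDerivWithinAt
  rw [← iteratedDerivWithin_succ] at h
  have hs : HasDerivWithinAt (fun t : ℝ => (a + b) / 2 + (b - a) / 2 * t) ((b - a) / 2)
      (Set.Icc (-1) 1) t := by
    simpa using (((hasDerivAt_id t).const_mul ((b - a) / 2)).const_add
      ((a + b) / 2)).hasDerivWithinAt
  have := (HasDerivWithinAt.scomp t h hs hmaps).const_smul (((b - a) / 2) ^ j)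
  rwa [smul_smul, ← pow_succ] at this

/-- For `r ∈ [0,2]` and integer `N ≥ 1` there is `c_N > 0`
(independent of `a, b, k, f`) such that for `a < b` with `h = (b−a)/2`, `hk ≥ 1`
and `f ∈ C^{N+1}[a,b]`,
`|I_k^{[a,b]}(f) − I_{k,N}^{[a,b]}(f)| ≤ c_N (1/k)^r h^{N+2−r} max_{[a,b]} |f^{(N+1)}|`. -/
theorem fcc_error_estimate_ab_smooth (r : ℝ) (hr : r ∈ Set.Icc (0 : ℝ) 2)
    (N : ℕ) (hN : 1 ≤ N) :
    ∃ c : ℝ, 0 < c ∧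
      ∀ a b : ℝ, a < b →
      ∀ k : ℝ, 1 ≤ (b - a) / 2 * k →
      ∀ f : ℝ → ℂ, ContDiffOn ℝ (((N + 1 : ℕ)) : ℕ∞) f (Set.Icc a b) →
        ‖Ikab k a b f - IkNab k N a b f‖ ≤
          c * (1 / k) ^ r * ((b - a) / 2) ^ ((N : ℝ) + 2 - r) *
            ⨆ x : Set.Icc a b, ‖iteratedDerivWithin (N + 1) f (Set.Icc a b) (x : ℝ)‖ := by
  obtain ⟨B, hB0, hB⟩ := exists_bound_IkN_error hN
  refine ⟨B + 1, by positivity, fun a b hab k hk f hf => ?_⟩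
  have hh : 0 < (b - a) / 2 := by linarith
  have hk0 : 0 < k := pos_of_mul_pos_right (zero_lt_one.trans_le hk) hh.le
  have hcont : ContinuousOn (iteratedDerivWithin (N + 1) f (Set.Icc a b)) (Set.Icc a b) :=
    hf.continuousOn_iteratedDerivWithin (by exact_mod_cast le_rfl) (uniqueDiffOn_Icc hab)
  set S := ⨆ x : Set.Icc a b, ‖iteratedDerivWithin (N + 1) f (Set.Icc a b) (x : ℝ)‖
  have hS0 : 0 ≤ S := Real.iSup_nonneg fun _ => norm_nonneg _
  have hbdd : BddAbove (Set.range fun x : Set.Icc a b =>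
      ‖iteratedDerivWithin (N + 1) f (Set.Icc a b) (x : ℝ)‖) := by
    obtain ⟨C, hC⟩ := isCompact_Icc.exists_bound_of_continuousOn hcont
    exact ⟨C, by rintro _ ⟨x, rfl⟩; exact hC x x.2⟩
  have hle : ∀ x ∈ Set.Icc a b, ‖iteratedDerivWithin (N + 1) f (Set.Icc a b) x‖ ≤ S :=
    fun x hx => le_ciSup hbdd ⟨x, hx⟩
  rw [Ikab_eq_integral_unit, IkNab, ← mul_sub]
  have hmaps : Set.MapsTo (fun t : ℝ => (a + b) / 2 + (b - a) / 2 * t)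
      (Set.Icc (-1) 1) (Set.Icc a b) := fun t ht => by
    constructor <;> nlinarith [ht.1, ht.2]
  have key := hB (fun j t => ((b - a) / 2) ^ j •
        iteratedDerivWithin j f (Set.Icc a b) ((a + b) / 2 + (b - a) / 2 * t))
    (((b - a) / 2) ^ (N + 1) * S) ((b - a) / 2 * k) hk
    (fun j hj t ht => hasDerivWithinAt_iteratedDerivWithin_rescale hab hf hj ht)
    ((hcont.comp (by fun_prop) hmaps).const_smul (((b - a) / 2) ^ (N + 1)))
    (fun t ht => by
      rw [norm_smul, norm_pow, Real.norm_of_nonneg hh.le]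
      gcongr
      exact hle _ (hmaps ht))
  simp only [pow_zero, one_smul, iteratedDerivWithin_zero] at key
  have hexp : ‖Complex.exp (Complex.I * k * (((a + b) / 2 : ℝ) : ℂ))‖ = 1 := by
    rw [show Complex.I * (k : ℂ) * (((a + b) / 2 : ℝ) : ℂ) =
      ((k * ((a + b) / 2) : ℝ) : ℂ) * Complex.I by push_cast; ring]
    exact Complex.norm_exp_ofReal_mul_I _
  rw [norm_mul, norm_mul, hexp, mul_one, Complex.norm_real, Real.norm_of_nonneg hh.le]
  generalize (b - a) / 2 = h at *
  have hK0 : 0 < h * k := mul_pos hh hk0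
  have hpow : 1 / (h * k) ^ 2 ≤ (1 / k) ^ r * h ^ (-r) := by
    rw [Real.rpow_neg hh.le, one_div k, Real.inv_rpow hk0.le, ← mul_inv,
      ← Real.mul_rpow hk0.le hh.le,
      mul_comm k h, ← one_div]
    gcongr
    rw [← Real.rpow_natCast]
    exact Real.rpow_le_rpow_of_exponent_le hk (by simpa using hr.2)
  have hsplit : h ^ ((N : ℝ) + 2 - r) = h ^ (N + 2) * h ^ (-r) := by
    rw [sub_eq_add_neg, Real.rpow_add hh]
    congr 1
    exact_mod_cast Real.rpow_natCast h (N + 2)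
  calc _ ≤ h * (B * (h ^ (N + 1) * S) / (h * k) ^ 2) := by gcongr
    _ = B * h ^ (N + 2) * S * (1 / (h * k) ^ 2) := by ring
    _ ≤ (B + 1) * h ^ (N + 2) * S * ((1 / k) ^ r * h ^ (-r)) := by
        gcongr
        linarith
    _ = _ := by rw [hsplit]; ring
end

section
/- Let β ∈ (−1,0). There exists a constant C_β > 0 such that for every f ∈ C¹_β[0,1], every ε ∈ (0,1], every k > 0 and every s ∈ [0, 1+β], |∫_0^ε f(x) exp(ikx) dx| ≤ C_β ε^{1+β−s} (1/k)^s ‖f‖_{1,β}. -/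
open scoped Real

/-- For `β ∈ (−1,0)`: the set of values `|x^{j−β} v^{(j)}(x)|` for `j = 0,…,m`,
`x ∈ (0,1]`, whose supremum is `‖v‖_{m,β}`. -/
noncomputable def snormSetNeg (m : ℕ) (β : ℝ) (f : ℝ → ℂ) : Set ℝ :=
  {y | ∃ j ≤ m, ∃ x ∈ Set.Ioc (0 : ℝ) 1,
    y = x ^ ((j : ℝ) - β) * ‖iteratedDerivWithin j f (Set.Ioc (0 : ℝ) 1) x‖}

/-- `‖v‖_{m,β} = max_{0 ≤ j ≤ m} sup_{x ∈ (0,1]} |x^{j−β} v^{(j)}(x)|` for `β ∈ (−1,0)`. -/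
noncomputable def snormNeg (m : ℕ) (β : ℝ) (f : ℝ → ℂ) : ℝ := sSup (snormSetNeg m β f)

/-- The exponential factor has modulus one. -/
theorem norm_exp_I_mul_ofReal_mul_ofReal (k x : ℝ) :
    ‖Complex.exp (Complex.I * k * x)‖ = 1 := by
  rw [mul_assoc, ← Complex.ofReal_mul, mul_comm, Complex.norm_exp_ofReal_mul_I]

/-- The weight bound `‖f x‖ ≤ M x^β` makes the oscillating product integrable over `[0, a]`. -/
theorem intervalIntegrable_mul_exp_of_rpow_bound {f : ℝ → ℂ} {β M a : ℝ} (k : ℝ) (hβ : -1 < β)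
    (ha : 0 ≤ a) (hf : ContinuousOn f (Set.Ioc 0 a))
    (hM : ∀ x ∈ Set.Ioc 0 a, ‖f x‖ ≤ M * x ^ β) :
    IntervalIntegrable (fun x : ℝ => f x * Complex.exp (Complex.I * k * x))
      MeasureTheory.volume 0 a := by
  have hg : IntervalIntegrable (fun x : ℝ => M * x ^ β) MeasureTheory.volume 0 a :=
    (intervalIntegral.intervalIntegrable_rpow' hβ).const_mul M
  rw [intervalIntegrable_iff_integrableOn_Ioc_of_le ha] at hg ⊢
  have hc : ContinuousOn (fun x : ℝ => f x * Complex.exp (Complex.I * k * x)) (Set.Ioc 0 a) :=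
    hf.mul (by fun_prop)
  refine MeasureTheory.Integrable.mono' hg (hc.aestronglyMeasurable measurableSet_Ioc) ?_
  filter_upwards [MeasureTheory.ae_restrict_mem measurableSet_Ioc] with x hx
  rw [norm_mul, norm_exp_I_mul_ofReal_mul_ofReal, mul_one]
  exact hM x hx

/-- Absolute-value bound near the singularity. -/
theorem norm_integral_mul_exp_le_of_rpow_bound {f : ℝ → ℂ} {β M a : ℝ} (k : ℝ) (hβ : -1 < β)
    (ha : 0 ≤ a) (hM : ∀ x ∈ Set.Ioc 0 a, ‖f x‖ ≤ M * x ^ β) :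
    ‖∫ x in (0 : ℝ)..a, f x * Complex.exp (Complex.I * k * x)‖ ≤
      M * (a ^ (1 + β) / (1 + β)) := by
  have hg : IntervalIntegrable (fun x : ℝ => M * x ^ β) MeasureTheory.volume 0 a :=
    (intervalIntegral.intervalIntegrable_rpow' hβ).const_mul M
  refine (intervalIntegral.norm_integral_le_of_norm_le ha ?_ hg).trans_eq ?_
  · filter_upwards with x hx
    rw [norm_mul, norm_exp_I_mul_ofReal_mul_ofReal, mul_one]
    exact hM x hx
  · rw [intervalIntegral.integral_const_mul, integral_rpow (Or.inl hβ),
      Real.zero_rpow (by linarith), sub_zero, add_comm β 1]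

/-- Integration by parts away from the singularity. -/
theorem norm_integral_mul_exp_le_of_deriv_rpow_bound {f f' : ℝ → ℂ} {β M a b k : ℝ}
    (hβ : β < 0) (hk : 0 < k) (ha : 0 < a) (hab : a ≤ b)
    (hf : ContinuousOn f (Set.Icc a b)) (hf' : ContinuousOn f' (Set.Icc a b))
    (hd : ∀ x ∈ Set.Ioo a b, HasDerivAt f (f' x) x)
    (hM : ∀ x ∈ Set.Icc a b, ‖f x‖ ≤ M * x ^ β)
    (hM' : ∀ x ∈ Set.Icc a b, ‖f' x‖ ≤ M * x ^ (β - 1)) :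
    ‖∫ x in a..b, f x * Complex.exp (Complex.I * k * x)‖ ≤
      M * (1 / k) * (b ^ β + a ^ β + (b ^ β - a ^ β) / β) := by
  have hc : Complex.I * (k : ℂ) ≠ 0 :=
    mul_ne_zero Complex.I_ne_zero (Complex.ofReal_ne_zero.mpr hk.ne')
  have hnorm (x : ℝ) : ‖Complex.exp (Complex.I * k * x) / (Complex.I * k)‖ = 1 / k := by
    rw [norm_div, norm_exp_I_mul_ofReal_mul_ofReal, norm_mul, Complex.norm_I, one_mul,
      Complex.norm_real, Real.norm_of_nonneg hk.le]
  have hexp (x : ℝ) : HasDerivAt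
      (fun x : ℝ => Complex.exp (Complex.I * k * x) / (Complex.I * k))
      (Complex.exp (Complex.I * k * x)) x := by
    have h := (((Complex.ofRealCLM.hasDerivAt (x := x)).const_mul
      (Complex.I * (k : ℂ))).cexp).div_const (Complex.I * (k : ℂ))
    rw [mul_div_assoc] at h
    simpa [hc] using h
  have hparts := intervalIntegral.integral_mul_deriv_eq_deriv_mul_of_hasDerivAt
    (u := f) (u' := f') (a := a) (b := b)
    (v := fun x : ℝ => Complex.exp (Complex.I * k * x) / (Complex.I * k))
    (v' := fun x : ℝ => Complex.exp (Complex.I * k * x))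
    (by rwa [Set.uIcc_of_le hab]) (by fun_prop)
    (by rwa [min_eq_left hab, max_eq_right hab]) (fun x _ => hexp x)
    (ContinuousOn.intervalIntegrable (by rwa [Set.uIcc_of_le hab]))
    (Continuous.intervalIntegrable (by fun_prop) _ _)
  have h0 : (0 : ℝ) ∉ Set.uIcc a b := by
    rw [Set.uIcc_of_le hab]; exact fun h => ha.not_ge h.1
  have hrest : ‖∫ x in a..b, f' x * (Complex.exp (Complex.I * k * x) / (Complex.I * k))‖ ≤
      M * (1 / k) * ((b ^ β - a ^ β) / β) := by
    have hg : IntervalIntegrable (fun x : ℝ => M * (1 / k) * x ^ (β - 1))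
        MeasureTheory.volume a b :=
      (intervalIntegral.intervalIntegrable_rpow (Or.inr h0)).const_mul _
    refine (intervalIntegral.norm_integral_le_of_norm_le hab ?_ hg).trans_eq ?_
    · filter_upwards with x hx
      rw [norm_mul, hnorm]
      have := mul_le_mul_of_nonneg_right (hM' x ⟨hx.1.le, hx.2⟩) (one_div_nonneg.mpr hk.le)
      linarith
    · rw [intervalIntegral.integral_const_mul, integral_rpow (Or.inr ⟨by linarith, h0⟩),
        sub_add_cancel]
  have hend {x : ℝ} (hx : x ∈ Set.Icc a b) :
      ‖f x * (Complex.exp (Complex.I * k * x) / (Complex.I * k))‖ ≤ M * (1 / k) * x ^ β := by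
    rw [norm_mul, hnorm]
    have := mul_le_mul_of_nonneg_right (hM x hx) (one_div_nonneg.mpr hk.le)
    linarith
  rw [hparts]
  refine (norm_sub_le _ _).trans ((add_le_add_left (norm_sub_le _ _) _).trans ?_)
  have h1 := hend (Set.right_mem_Icc.mpr hab)
  have h2 := hend (Set.left_mem_Icc.mpr hab)
  linarith

/-- A power of the smaller of two scales splits between both of them. -/
theorem rpow_le_rpow_sub_mul_rpow {a x y t s : ℝ} (ha : 0 < a) (hx : a ≤ x) (hy : a ≤ y)
    (hs : 0 ≤ s) (hst : s ≤ t) : a ^ t ≤ x ^ (t - s) * y ^ s := by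
  calc a ^ t = a ^ (t - s) * a ^ s := by rw [← Real.rpow_add ha, sub_add_cancel]
    _ ≤ x ^ (t - s) * y ^ s := by
      have hx0 := ha.trans_le hx
      have hts := sub_nonneg.mpr hst
      gcongr

theorem norm_iteratedDerivWithin_le_snormNeg {m j : ℕ} {β x : ℝ} {f : ℝ → ℂ}
    (hb : BddAbove (snormSetNeg m β f)) (hj : j ≤ m) (hx : x ∈ Set.Ioc (0 : ℝ) 1) :
    ‖iteratedDerivWithin j f (Set.Ioc (0 : ℝ) 1) x‖ ≤ snormNeg m β f * x ^ (β - j) := by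
  have h : x ^ ((j : ℝ) - β) * ‖iteratedDerivWithin j f (Set.Ioc (0 : ℝ) 1) x‖ ≤ snormNeg m β f :=
    le_csSup hb ⟨j, hj, x, hx, rfl⟩
  have hp := Real.rpow_pos_of_pos hx.1 (β - j)
  have hinv : x ^ ((j : ℝ) - β) * x ^ (β - j) = 1 := by
    rw [← Real.rpow_add hx.1]; simp
  calc ‖iteratedDerivWithin j f (Set.Ioc (0 : ℝ) 1) x‖
      = x ^ ((j : ℝ) - β) * ‖iteratedDerivWithin j f (Set.Ioc (0 : ℝ) 1) x‖ * x ^ (β - j) := by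
        rw [mul_right_comm, hinv, one_mul]
    _ ≤ _ := mul_le_mul_of_nonneg_right h hp.le

/-- Let `β ∈ (−1,0)`. There is `C_β > 0` such that for every
`f ∈ C¹_β[0,1]`, `ε ∈ (0,1]`, `k > 0` and `s ∈ [0, 1+β]`,
`|∫_0^ε f(x) exp(ikx) dx| ≤ C_β ε^{1+β−s} (1/k)^s ‖f‖_{1,β}`. -/
theorem singular_integral_estimate_neg (β : ℝ) (hβ : β ∈ Set.Ioo (-1 : ℝ) 0) :
    ∃ C : ℝ, 0 < C ∧
      ∀ f : ℝ → ℂ,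
        ContDiffOn ℝ 1 f (Set.Ioc (0 : ℝ) 1) →
        BddAbove (snormSetNeg 1 β f) →
        ∀ ε ∈ Set.Ioc (0 : ℝ) 1, ∀ k : ℝ, 0 < k → ∀ s ∈ Set.Icc (0 : ℝ) (1 + β),
          ‖∫ x in (0 : ℝ)..ε, f x * Complex.exp (Complex.I * k * x)‖ ≤
            C * ε ^ (1 + β - s) * (1 / k) ^ s * snormNeg 1 β f := by
  obtain ⟨hβ1, hβ0⟩ := hβ
  have h1β : 0 < 1 + β := by linarith
  have hC : 0 < 1 / (1 + β) + 2 + 1 / (-β) := by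
    have := one_div_pos.mpr h1β
    have := one_div_pos.mpr (neg_pos.mpr hβ0)
    linarith
  refine ⟨_, hC, ?_⟩
  intro f hf hb ε hε k hk s hs
  obtain ⟨hε0, hε1⟩ := hε
  set M := snormNeg 1 β f
  set f' : ℝ → ℂ := derivWithin f (Set.Ioc (0 : ℝ) 1)
  have hM (x : ℝ) (hx : x ∈ Set.Ioc (0 : ℝ) 1) : ‖f x‖ ≤ M * x ^ β := by
    simpa using norm_iteratedDerivWithin_le_snormNeg hb (Nat.zero_le 1) hx
  have hM' (x : ℝ) (hx : x ∈ Set.Ioc (0 : ℝ) 1) : ‖f' x‖ ≤ M * x ^ (β - 1) := by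
    simpa [iteratedDerivWithin_one] using norm_iteratedDerivWithin_le_snormNeg hb le_rfl hx
  have hM0 : 0 ≤ M := by
    simpa using (norm_nonneg _).trans (hM 1 ⟨one_pos, le_rfl⟩)
  have hsub {b : ℝ} (hbε : b ≤ ε) : Set.Ioc 0 b ⊆ Set.Ioc (0 : ℝ) 1 :=
    Set.Ioc_subset_Ioc_right (hbε.trans hε1)
  have hscale {a D : ℝ} (ha : 0 < a) (haε : a ≤ ε) (hak : a ≤ 1 / k)
      (hD : D ≤ 1 / (1 + β) + 2 + 1 / (-β)) :
      M * a ^ (1 + β) * D ≤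
        (1 / (1 + β) + 2 + 1 / (-β)) * ε ^ (1 + β - s) * (1 / k) ^ s * M := by
    have h1 := rpow_le_rpow_sub_mul_rpow ha haε hak hs.1 hs.2
    calc M * a ^ (1 + β) * D ≤ M * a ^ (1 + β) * (1 / (1 + β) + 2 + 1 / (-β)) := by gcongr
      _ ≤ M * (ε ^ (1 + β - s) * (1 / k) ^ s) * (1 / (1 + β) + 2 + 1 / (-β)) := by gcongr
      _ = _ := by ring
  rcases le_or_gt ε (1 / k) with h | h
  · refine (norm_integral_mul_exp_le_of_rpow_bound k hβ1 hε0.le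
      fun x hx => hM x (hsub le_rfl hx)).trans ?_
    refine le_trans (le_of_eq ?_) (hscale (D := 1 / (1 + β)) hε0 le_rfl h ?_)
    · ring
    · have := one_div_pos.mpr (neg_pos.mpr hβ0)
      linarith
  · set a := 1 / k
    have ha : 0 < a := one_div_pos.mpr hk
    have hIcc : Set.Icc a ε ⊆ Set.Ioc (0 : ℝ) 1 := fun x hx =>
      ⟨ha.trans_le hx.1, hx.2.trans hε1⟩
    have hint := intervalIntegrable_mul_exp_of_rpow_bound k hβ1 hε0.le
      (hf.continuousOn.mono (hsub le_rfl)) fun x hx => hM x (hsub le_rfl hx)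
    have hmem : a ∈ Set.uIcc 0 ε := by
      rw [Set.uIcc_of_le hε0.le]; exact ⟨ha.le, h.le⟩
    rw [← intervalIntegral.integral_add_adjacent_intervals
      (hint.mono_set (Set.uIcc_subset_uIcc_left hmem))
      (hint.mono_set (Set.uIcc_subset_uIcc_right hmem))]
    have hnear := norm_integral_mul_exp_le_of_rpow_bound k hβ1 ha.le
      fun x hx => hM x (hsub h.le hx)
    have hfar := norm_integral_mul_exp_le_of_deriv_rpow_bound (f' := f') hβ0 hk ha h.le
      (hf.continuousOn.mono hIcc)
      ((hf.continuousOn_derivWithin (uniqueDiffOn_Ioc 0 1) le_rfl).mono hIcc)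
      (fun x hx => ((hf.differentiableOn one_ne_zero x
        (hIcc (Set.Ioo_subset_Icc_self hx))).hasDerivWithinAt).hasDerivAt
          (Ioc_mem_nhds (ha.trans hx.1) (hx.2.trans_le hε1)))
      (fun x hx => hM x (hIcc hx)) (fun x hx => hM' x (hIcc hx))
    have hεa : ε ^ β ≤ a ^ β := Real.rpow_le_rpow_of_nonpos ha h.le hβ0.le
    have hε_nonneg : 0 ≤ ε ^ β := (Real.rpow_pos_of_pos hε0 β).le
    have hbracket : ε ^ β + a ^ β + (ε ^ β - a ^ β) / β ≤ a ^ β * (2 + 1 / (-β)) := by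
      have hdiv : ε ^ β / β ≤ 0 := div_nonpos_of_nonneg_of_nonpos hε_nonneg hβ0.le
      have heq : a ^ β * (2 + 1 / (-β)) = 2 * a ^ β - a ^ β / β := by
        rw [one_div, inv_neg]; ring
      rw [heq, sub_div]
      linarith
    have hfar' : M * a * (ε ^ β + a ^ β + (ε ^ β - a ^ β) / β) ≤
        M * a ^ (1 + β) * (2 + 1 / (-β)) := by
      rw [Real.rpow_add ha, Real.rpow_one]
      have := mul_le_mul_of_nonneg_left hbracket (mul_nonneg hM0 ha.le)
      linarith
    refine (norm_add_le _ _).trans ((add_le_add hnear (hfar.trans hfar')).trans ?_)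
    refine le_trans (le_of_eq ?_) (hscale ha h.le le_rfl le_rfl)
    ring
end

section
/- There exists a constant C₀ > 0 such that for every f ∈ C¹_0[0,1], every ε ∈ (0,1], every k ≥ 1 and every s ∈ [0,1], |∫_0^ε f(x) exp(ikx) dx| ≤ C₀ (ε + ε|log ε|)^{1−s} ((1 + log k)/k)^s ‖f‖_{1,0}. -/
open scoped Real

/-- For `β = 0` (logarithmic singularity): the set of values
`(|log x|+1)^{-1}|v(x)|` and `|x^j v^{(j)}(x)|` for `j = 1,…,m`, `x ∈ (0,1]`,
whose supremum is `‖v‖_{m,0}`. -/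
noncomputable def snormSetLog (m : ℕ) (f : ℝ → ℂ) : Set ℝ :=
  {y | (∃ x ∈ Set.Ioc (0 : ℝ) 1, y = (|Real.log x| + 1)⁻¹ * ‖f x‖) ∨
    (∃ j, 1 ≤ j ∧ j ≤ m ∧ ∃ x ∈ Set.Ioc (0 : ℝ) 1,
      y = x ^ j * ‖iteratedDerivWithin j f (Set.Ioc (0 : ℝ) 1) x‖)}

/-- The norm `‖v‖_{m,0}`. -/
noncomputable def snormLog (m : ℕ) (f : ℝ → ℂ) : ℝ := sSup (snormSetLog m f)

open MeasureTheory Set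

lemma norm_le_snormLog_mul {m : ℕ} {f : ℝ → ℂ} (hb : BddAbove (snormSetLog m f)) {x : ℝ}
    (hx : x ∈ Ioc (0 : ℝ) 1) : ‖f x‖ ≤ snormLog m f * (1 - Real.log x) := by
  have h : (|Real.log x| + 1)⁻¹ * ‖f x‖ ≤ snormLog m f := le_csSup hb (Or.inl ⟨x, hx, rfl⟩)
  rw [abs_of_nonpos (Real.log_nonpos hx.1.le hx.2),
    inv_mul_le_iff₀ (by linarith [Real.log_nonpos hx.1.le hx.2])] at h
  linarith

lemma norm_derivWithin_le_snormLog_mul {f : ℝ → ℂ} (hb : BddAbove (snormSetLog 1 f)) {x : ℝ}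
    (hx : x ∈ Ioc (0 : ℝ) 1) :
    ‖derivWithin f (Ioc (0 : ℝ) 1) x‖ ≤ snormLog 1 f * x⁻¹ := by
  have h : x ^ 1 * ‖iteratedDerivWithin 1 f (Ioc (0 : ℝ) 1) x‖ ≤ snormLog 1 f :=
    le_csSup hb (Or.inr ⟨1, le_rfl, le_rfl, x, hx, rfl⟩)
  rw [pow_one, iteratedDerivWithin_one, mul_comm, ← le_div_iff₀ hx.1] at h
  rwa [← div_eq_mul_inv]

lemma snormLog_nonneg {m : ℕ} {f : ℝ → ℂ} (hb : BddAbove (snormSetLog m f)) :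
    0 ≤ snormLog m f := by
  simpa using (norm_nonneg _).trans (norm_le_snormLog_mul hb (x := 1) (by simp))

lemma norm_mul_exp_I_mul (z : ℂ) (k x : ℝ) :
    ‖z * Complex.exp (Complex.I * k * x)‖ = ‖z‖ := by
  rw [norm_mul, mul_assoc, ← Complex.ofReal_mul, mul_comm Complex.I,
    Complex.norm_exp_ofReal_mul_I, mul_one]

lemma intervalIntegrable_one_sub_log (M a b : ℝ) :
    IntervalIntegrable (fun x ↦ M * (1 - Real.log x)) volume a b :=
  (intervalIntegrable_const.sub intervalIntegral.intervalIntegrable_log').const_mul M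

lemma continuousOn_mul_exp {f : ℝ → ℂ} {s : Set ℝ} (hf : ContinuousOn f s) (k : ℝ) :
    ContinuousOn (fun x ↦ f x * Complex.exp (Complex.I * k * x)) s :=
  hf.mul (by fun_prop)

lemma intervalIntegrable_mul_exp {f : ℝ → ℂ} (hf : ContinuousOn f (Ioc (0 : ℝ) 1))
    (hb : BddAbove (snormSetLog 1 f)) (k : ℝ) {a : ℝ} (ha : a ∈ Ioc (0 : ℝ) 1) :
    IntervalIntegrable (fun x ↦ f x * Complex.exp (Complex.I * k * x)) volume 0 a := by
  refine (intervalIntegrable_one_sub_log (snormLog 1 f) 0 a).mono_fun' ?_ ?_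
  · rw [uIoc_of_le ha.1.le]
    exact ((continuousOn_mul_exp hf k).mono
      (Ioc_subset_Ioc_right ha.2)).aestronglyMeasurable measurableSet_Ioc
  · rw [uIoc_of_le ha.1.le]
    filter_upwards [ae_restrict_mem measurableSet_Ioc] with x hx
    rw [norm_mul_exp_I_mul]
    exact norm_le_snormLog_mul hb ⟨hx.1, hx.2.trans ha.2⟩

lemma norm_integral_mul_exp_le_s7 {f : ℝ → ℂ} (hb : BddAbove (snormSetLog 1 f)) (k : ℝ) {a : ℝ}
    (ha : a ∈ Ioc (0 : ℝ) 1) :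
    ‖∫ x in (0 : ℝ)..a, f x * Complex.exp (Complex.I * k * x)‖ ≤
      2 * (snormLog 1 f * (a * (1 - Real.log a))) := by
  have h := intervalIntegral.norm_integral_le_of_norm_le ha.1.le (μ := volume)
    (f := fun x ↦ f x * Complex.exp (Complex.I * k * x))
    (Filter.Eventually.of_forall fun x hx ↦ by
      rw [norm_mul_exp_I_mul]
      exact norm_le_snormLog_mul hb ⟨hx.1, hx.2.trans ha.2⟩)
    (intervalIntegrable_one_sub_log (snormLog 1 f) 0 a)
  refine h.trans ?_
  rw [intervalIntegral.integral_const_mul, intervalIntegral.integral_sub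
    intervalIntegrable_const intervalIntegral.intervalIntegrable_log', integral_log]
  simp only [intervalIntegral.integral_const, smul_eq_mul]
  have := mul_nonneg (snormLog_nonneg hb)
    (mul_nonneg ha.1.le (neg_nonneg.2 (Real.log_nonpos ha.1.le ha.2)))
  linarith

/-- The bound obtained from integration by parts away from the singularity. -/
lemma norm_integral_mul_exp_le_of_pos {f : ℝ → ℂ} (hf : ContDiffOn ℝ 1 f (Ioc (0 : ℝ) 1))
    (hb : BddAbove (snormSetLog 1 f)) {k a b : ℝ} (hk : 0 < k) (ha : 0 < a) (hab : a ≤ b)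
    (hb1 : b ≤ 1) :
    ‖∫ x in a..b, f x * Complex.exp (Complex.I * k * x)‖ ≤
      snormLog 1 f * (2 - 2 * Real.log a) / k := by
  set M := snormLog 1 f
  set f' := derivWithin f (Ioc (0 : ℝ) 1)
  have hsub : Icc a b ⊆ Ioc (0 : ℝ) 1 := fun x hx ↦ ⟨ha.trans_le hx.1, hx.2.trans hb1⟩
  have hIk : Complex.I * k ≠ 0 := by simp [hk.ne']
  have hf' : ContinuousOn f' (Icc a b) :=
    (hf.continuousOn_derivWithin (uniqueDiffOn_Ioc 0 1) le_rfl).mono hsub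
  have hexp (x : ℝ) : HasDerivAt (fun x : ℝ ↦ Complex.exp (Complex.I * k * x) / (Complex.I * k))
      (Complex.exp (Complex.I * k * x)) x := by
    have h := (((hasDerivAt_id (x : ℂ)).const_mul (Complex.I * k)).cexp.div_const
      (Complex.I * k)).comp_ofReal
    simpa [hIk] using h
  have hparts := intervalIntegral.integral_mul_deriv_eq_deriv_mul_of_hasDerivAt
    (a := a) (b := b) (u := f) (u' := f')
    (v := fun x : ℝ ↦ Complex.exp (Complex.I * k * x) / (Complex.I * k))
    (v' := fun x : ℝ ↦ Complex.exp (Complex.I * k * x))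
    (by rw [uIcc_of_le hab]; exact hf.continuousOn.mono hsub)
    (by fun_prop)
    (fun x hx ↦ by
      rw [min_eq_left hab, max_eq_right hab] at hx
      exact ((hf.differentiableOn one_ne_zero x
        (hsub (Ioo_subset_Icc_self hx))).hasDerivWithinAt).hasDerivAt
        (Ioc_mem_nhds (ha.trans hx.1) (hx.2.trans_le hb1)))
    (fun x _ ↦ hexp x)
    (by rw [← uIcc_of_le hab] at hf'; exact hf'.intervalIntegrable)
    (by apply Continuous.intervalIntegrable; fun_prop)
  have hnorm (z : ℂ) (x : ℝ) :
      ‖z * (Complex.exp (Complex.I * k * x) / (Complex.I * k))‖ = ‖z‖ / k := by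
    rw [← mul_div_assoc, norm_div, norm_mul_exp_I_mul]
    simp [abs_of_pos hk]
  have hint : ‖∫ x in a..b, f' x * (Complex.exp (Complex.I * k * x) / (Complex.I * k))‖ ≤
      M / k * Real.log (b / a) := by
    rw [← integral_inv_of_pos ha (ha.trans_le hab), ← intervalIntegral.integral_const_mul]
    refine intervalIntegral.norm_integral_le_of_norm_le hab
      (Filter.Eventually.of_forall fun x hx ↦ ?_) ?_
    · rw [hnorm, div_mul_eq_mul_div]
      gcongr
      exact norm_derivWithin_le_snormLog_mul hb (hsub (Ioc_subset_Icc_self hx))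
    · refine (intervalIntegral.intervalIntegrable_inv (fun x hx ↦ ?_)
        continuousOn_id).const_mul _
      rw [uIcc_of_le hab] at hx
      exact (ha.trans_le hx.1).ne'
  rw [hparts]
  refine (norm_sub_le _ _).trans ((add_le_add (norm_sub_le _ _) hint).trans ?_)
  rw [hnorm, hnorm, Real.log_div (ha.trans_le hab).ne' ha.ne', div_mul_eq_mul_div, ← add_div,
    ← add_div]
  gcongr
  have h1 := norm_le_snormLog_mul hb (hsub (left_mem_Icc.2 hab))
  have h2 := norm_le_snormLog_mul hb (hsub (right_mem_Icc.2 hab))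
  linarith

lemma mul_one_sub_log_le {a b : ℝ} (ha : 0 < a) (hab : a ≤ b) (hb : b ≤ 1) :
    a * (1 - Real.log a) ≤ b * (1 - Real.log b) := by
  have hb0 := ha.trans_le hab
  have h : Real.log b - Real.log a ≤ b / a - 1 := by
    rw [← Real.log_div hb0.ne' ha.ne']
    exact Real.log_le_sub_one_of_pos (div_pos hb0 ha)
  have h' : a * (Real.log b - Real.log a) ≤ b - a := by
    calc _ ≤ a * (b / a - 1) := by gcongr
      _ = b - a := by field_simp
  nlinarith [mul_nonneg (sub_nonneg.2 hab) (neg_nonneg.2 (Real.log_nonpos hb0.le hb))]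

lemma norm_integral_mul_exp_le_decay {f : ℝ → ℂ} (hf : ContDiffOn ℝ 1 f (Ioc (0 : ℝ) 1))
    (hb : BddAbove (snormSetLog 1 f)) {k ε : ℝ} (hk : 1 ≤ k) (hε : ε ∈ Ioc (0 : ℝ) 1) :
    ‖∫ x in (0 : ℝ)..ε, f x * Complex.exp (Complex.I * k * x)‖ ≤
      4 * (snormLog 1 f * ((1 + Real.log k) / k)) := by
  have hM := snormLog_nonneg hb
  have hk0 : 0 < k := one_pos.trans_le hk
  have hk1 : k⁻¹ ∈ Ioc (0 : ℝ) 1 := ⟨inv_pos.2 hk0, inv_le_one_of_one_le₀ hk⟩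
  have hL : k⁻¹ * (1 - Real.log k⁻¹) = (1 + Real.log k) / k := by
    rw [Real.log_inv]; field_simp; ring
  have hB : 0 ≤ snormLog 1 f * ((1 + Real.log k) / k) :=
    mul_nonneg hM (div_nonneg (by linarith [Real.log_nonneg hk]) hk0.le)
  rcases le_total ε k⁻¹ with h | h
  · have h1 := norm_integral_mul_exp_le_s7 hb k hε
    have h2 := mul_le_mul_of_nonneg_left (mul_one_sub_log_le hε.1 h hk1.2) hM
    rw [hL] at h2
    linarith
  · have hi := intervalIntegrable_mul_exp hf.continuousOn hb k hk1
    rw [← intervalIntegral.integral_add_adjacent_intervals hi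
      (hi.symm.trans (intervalIntegrable_mul_exp hf.continuousOn hb k hε))]
    have h1 := norm_integral_mul_exp_le_s7 hb k hk1
    have h2 := norm_integral_mul_exp_le_of_pos hf hb hk0 hk1.1 h hε.2
    rw [hL] at h1
    rw [Real.log_inv] at h2
    have h3 : snormLog 1 f * (2 - 2 * -Real.log k) / k =
        2 * (snormLog 1 f * ((1 + Real.log k) / k)) := by ring
    refine (norm_add_le _ _).trans ?_
    linarith

lemma le_rpow_mul_rpow {x a b s : ℝ} (hx : 0 ≤ x) (ha : x ≤ a) (hb : x ≤ b)
    (hs : s ∈ Icc (0 : ℝ) 1) : x ≤ a ^ (1 - s) * b ^ s := by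
  have hs' : 0 ≤ 1 - s := sub_nonneg.2 hs.2
  calc x = x ^ (1 - s) * x ^ s := by
        rw [← Real.rpow_add_of_nonneg hx hs' hs.1, sub_add_cancel, Real.rpow_one]
    _ ≤ a ^ (1 - s) * b ^ s :=
        mul_le_mul (Real.rpow_le_rpow hx ha hs') (Real.rpow_le_rpow hx hb hs.1)
          (Real.rpow_nonneg hx _) (Real.rpow_nonneg (hx.trans ha) _)

/-- There is `C₀ > 0` such that for every `f ∈ C¹_0[0,1]`, `ε ∈ (0,1]`,
`k ≥ 1` and `s ∈ [0,1]`,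
`|∫_0^ε f(x) exp(ikx) dx| ≤ C₀ (ε + ε|log ε|)^{1−s} ((1 + log k)/k)^s ‖f‖_{1,0}`. -/
theorem singular_integral_estimate_log :
    ∃ C : ℝ, 0 < C ∧
      ∀ f : ℝ → ℂ,
        ContDiffOn ℝ 1 f (Set.Ioc (0 : ℝ) 1) →
        BddAbove (snormSetLog 1 f) →
        ∀ ε ∈ Set.Ioc (0 : ℝ) 1, ∀ k : ℝ, 1 ≤ k → ∀ s ∈ Set.Icc (0 : ℝ) 1,
          ‖∫ x in (0 : ℝ)..ε, f x * Complex.exp (Complex.I * k * x)‖ ≤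
            C * (ε + ε * |Real.log ε|) ^ (1 - s) * ((1 + Real.log k) / k) ^ s *
              snormLog 1 f := by
  refine ⟨4, by norm_num, fun f hf hb ε hε k hk s hs ↦ ?_⟩
  set M := snormLog 1 f
  have hM : 0 ≤ M := snormLog_nonneg hb
  have hlog : |Real.log ε| = -Real.log ε := abs_of_nonpos (Real.log_nonpos hε.1.le hε.2)
  set A := ε + ε * |Real.log ε|
  set B := (1 + Real.log k) / k
  have hA : 0 ≤ A := add_nonneg hε.1.le (mul_nonneg hε.1.le (abs_nonneg _))
  have hB : 0 ≤ B := div_nonneg (by linarith [Real.log_nonneg hk]) (by linarith)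
  have h1 : ‖∫ x in (0 : ℝ)..ε, f x * Complex.exp (Complex.I * k * x)‖ ≤ 4 * M * A := by
    have h := norm_integral_mul_exp_le_s7 hb k hε
    rw [show ε * (1 - Real.log ε) = A by simp only [A, hlog]; ring] at h
    linarith [mul_nonneg hM hA]
  have h2 : ‖∫ x in (0 : ℝ)..ε, f x * Complex.exp (Complex.I * k * x)‖ ≤ 4 * M * B := by
    linarith [norm_integral_mul_exp_le_decay hf hb hk hε]
  refine (le_rpow_mul_rpow (norm_nonneg _) h1 h2 hs).trans_eq ?_
  have hM4 : 0 ≤ 4 * M := by positivity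
  have hsplit : (4 * M) ^ (1 - s) * (4 * M) ^ s = 4 * M := by
    rw [← Real.rpow_add_of_nonneg hM4 (sub_nonneg.2 hs.2) hs.1, sub_add_cancel, Real.rpow_one]
  rw [Real.mul_rpow hM4 hA, Real.mul_rpow hM4 hB, mul_mul_mul_comm, hsplit]
  ring
end

section
/- Let β ∈ (0,1). There exists a constant C_β > 0 such that for every f ∈ C²_β[0,1], every ε ∈ (0,1], every k > 0 and every s ∈ [0,1], |∫_0^ε f(x) exp(ikx) dx| ≤ C_β ε^{1−s} (1/k)^s ‖f‖_{1,β}. -/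
open scoped Real

/-- For `β ∈ (0,1)`: the set of values `|v(x)|` for `x ∈ [0,1]` and
`|x^{j−β} v^{(j)}(x)|` for `j = 1,…,m`, `x ∈ (0,1]`, whose supremum is `‖v‖_{m,β}`. -/
noncomputable def snormSetPos (m : ℕ) (β : ℝ) (f : ℝ → ℂ) : Set ℝ :=
  {y | (∃ x ∈ Set.Icc (0 : ℝ) 1, y = ‖f x‖) ∨
    (∃ j, 1 ≤ j ∧ j ≤ m ∧ ∃ x ∈ Set.Ioc (0 : ℝ) 1,
      y = x ^ ((j : ℝ) - β) * ‖iteratedDerivWithin j f (Set.Ioc (0 : ℝ) 1) x‖)}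

/-- The norm `‖v‖_{m,β}` for `β ∈ (0,1)`. -/
noncomputable def snormPos (m : ℕ) (β : ℝ) (f : ℝ → ℂ) : ℝ := sSup (snormSetPos m β f)

open MeasureTheory Set

theorem norm_apply_le_snormPos {m : ℕ} {β : ℝ} {f : ℝ → ℂ} (hf : BddAbove (snormSetPos m β f))
    {x : ℝ} (hx : x ∈ Icc (0 : ℝ) 1) : ‖f x‖ ≤ snormPos m β f :=
  le_csSup hf (Or.inl ⟨x, hx, rfl⟩)

theorem snormSetPos_mono {m n : ℕ} (hmn : m ≤ n) (β : ℝ) (f : ℝ → ℂ) :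
    snormSetPos m β f ⊆ snormSetPos n β f := by
  rintro y (h | ⟨j, hj, hjm, h⟩)
  · exact Or.inl h
  · exact Or.inr ⟨j, hj, hjm.trans hmn, h⟩

theorem norm_deriv_le_snormPos {β : ℝ} {f : ℝ → ℂ} (hf : BddAbove (snormSetPos 1 β f))
    {x : ℝ} (hx : x ∈ Ioo (0 : ℝ) 1) : ‖deriv f x‖ ≤ snormPos 1 β f * x ^ (β - 1) := by
  have h : x ^ (1 - β) * ‖deriv f x‖ ≤ snormPos 1 β f := by
    refine le_csSup hf (Or.inr ⟨1, le_rfl, le_rfl, x, ⟨hx.1, hx.2.le⟩, ?_⟩)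
    rw [iteratedDerivWithin_one, derivWithin_of_mem_nhds (Ioc_mem_nhds hx.1 hx.2), Nat.cast_one]
  have hpow : x ^ (β - 1) * x ^ (1 - β) = 1 := by
    rw [← Real.rpow_add hx.1]; simp
  calc ‖deriv f x‖ = (x ^ (1 - β) * ‖deriv f x‖) * x ^ (β - 1) := by
        linear_combination (-‖deriv f x‖) * hpow
    _ ≤ _ := by gcongr; exact Real.rpow_nonneg hx.1.le _

/-- Integration by parts gains a factor `1 / k` for an oscillatory integral whose amplitude has an
integrable power-type singularity in its derivative at the left endpoint. -/
theorem norm_integral_mul_exp_le_div {β M ε k : ℝ} {f : ℝ → ℂ} (hβ : 0 < β) (hε : ε ∈ Ioc (0 : ℝ) 1)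
    (hk : 0 < k) (hM : 0 ≤ M) (hc : ContinuousOn f (Icc 0 ε))
    (hd : ∀ x ∈ Ioo 0 ε, DifferentiableAt ℝ f x) (hb : ∀ x ∈ Icc 0 ε, ‖f x‖ ≤ M)
    (hb' : ∀ x ∈ Ioo 0 ε, ‖deriv f x‖ ≤ M * x ^ (β - 1)) :
    ‖∫ x in (0 : ℝ)..ε, f x * Complex.exp (Complex.I * k * x)‖ ≤ (2 + 1 / β) * M * (1 / k) := by
  have hexp (x : ℝ) : ‖Complex.exp (Complex.I * k * x)‖ = 1 := by
    rw [show Complex.I * k * x = ((k * x : ℝ) : ℂ) * Complex.I by push_cast; ring]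
    exact Complex.norm_exp_ofReal_mul_I _
  have hIk : Complex.I * k ≠ 0 := by simp [hk.ne']
  set v : ℝ → ℂ := fun x => Complex.exp (Complex.I * k * x) / (Complex.I * k) with hv
  have hvn (x : ℝ) : ‖v x‖ = 1 / k := by
    simp [hv, hexp, abs_of_pos hk]
  have hvd (x : ℝ) : HasDerivAt v (Complex.exp (Complex.I * k * x)) x := by
    have h1 : HasDerivAt (fun x : ℝ => Complex.I * k * (x : ℂ)) (Complex.I * k) x := by
      simpa using (Complex.ofRealCLM.hasDerivAt (x := x)).const_mul (Complex.I * k)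
    have h2 := h1.cexp.div_const (Complex.I * k)
    rwa [mul_div_cancel_right₀ _ hIk] at h2
  have hvc : Continuous v := continuous_iff_continuousAt.2 fun x => (hvd x).continuousAt
  have hae : ∀ᵐ x : ℝ, x ≠ ε := by simp [ae_iff, measure_singleton]
  have hgi : IntervalIntegrable (fun x : ℝ => M * x ^ (β - 1)) volume 0 ε :=
    (intervalIntegral.intervalIntegrable_rpow' (by linarith)).const_mul M
  have hfi : IntervalIntegrable (deriv f) volume 0 ε := by
    refine hgi.mono_fun' (stronglyMeasurable_deriv f).aestronglyMeasurable ?_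
    rw [uIoc_of_le hε.1.le, Filter.EventuallyLE, ae_restrict_iff' measurableSet_Ioc]
    filter_upwards [hae] with x hx hx'
    exact hb' x ⟨hx'.1, lt_of_le_of_ne hx'.2 hx⟩
  have hparts := intervalIntegral.integral_mul_deriv_eq_deriv_mul_of_hasDerivAt
    (a := 0) (b := ε) (u := f) (v := v) (u' := deriv f)
    (v' := fun x : ℝ => Complex.exp (Complex.I * k * x))
    (by rwa [uIcc_of_le hε.1.le]) hvc.continuousOn
    (by
      rw [min_eq_left hε.1.le, max_eq_right hε.1.le]
      exact fun x hx => (hd x hx).hasDerivAt)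
    (fun x _ => hvd x) hfi (Continuous.intervalIntegrable (by fun_prop) _ _)
  have hint : ‖∫ x in (0 : ℝ)..ε, deriv f x * v x‖ ≤ M * (1 / β) * (1 / k) := by
    have h1 : ‖∫ x in (0 : ℝ)..ε, deriv f x * v x‖ ≤
        ∫ x in (0 : ℝ)..ε, M * x ^ (β - 1) * (1 / k) := by
      refine intervalIntegral.norm_integral_le_of_norm_le hε.1.le ?_ (hgi.mul_const _)
      filter_upwards [hae] with x hx hx'
      rw [norm_mul, hvn]
      gcongr
      exact hb' x ⟨hx'.1, lt_of_le_of_ne hx'.2 hx⟩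
    refine h1.trans ?_
    rw [intervalIntegral.integral_mul_const, intervalIntegral.integral_const_mul,
      integral_rpow (Or.inl (by linarith))]
    simp only [sub_add_cancel, Real.zero_rpow hβ.ne', sub_zero]
    gcongr
    exact Real.rpow_le_one hε.1.le hε.2 hβ.le
  have hbd (x : ℝ) (hx : x ∈ Icc 0 ε) : ‖f x * v x‖ ≤ M * (1 / k) := by
    rw [norm_mul, hvn]
    gcongr
    exact hb x hx
  rw [hparts]
  calc _ ≤ ‖f ε * v ε‖ + ‖f 0 * v 0‖ + ‖∫ x in (0 : ℝ)..ε, deriv f x * v x‖ :=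
        (norm_sub_le _ _).trans (by gcongr; exact norm_sub_le _ _)
    _ ≤ M * (1 / k) + M * (1 / k) + M * (1 / β) * (1 / k) := by
        gcongr
        · exact hbd ε ⟨hε.1.le, le_rfl⟩
        · exact hbd 0 ⟨le_rfl, hε.1.le⟩
    _ = _ := by ring

/-- A number below both `K * a` and `K * b` is below `K` times any weighted geometric mean of
`a` and `b`. -/
theorem le_mul_rpow_mul_rpow {A K a b s : ℝ} (hA : 0 ≤ A) (hK : 0 ≤ K) (ha : 0 ≤ a) (hb : 0 ≤ b)
    (hs : s ∈ Icc (0 : ℝ) 1) (h₁ : A ≤ K * a) (h₂ : A ≤ K * b) :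
    A ≤ K * a ^ (1 - s) * b ^ s := by
  have hsplit {x : ℝ} (hx : 0 ≤ x) : x ^ (1 - s) * x ^ s = x := by
    rw [← Real.rpow_add_of_nonneg hx (by linarith [hs.2]) hs.1]; simp
  calc A = A ^ (1 - s) * A ^ s := (hsplit hA).symm
    _ ≤ (K * a) ^ (1 - s) * (K * b) ^ s := by
        gcongr
        · linarith [hs.2]
        · exact hs.1
    _ = (K ^ (1 - s) * K ^ s) * a ^ (1 - s) * b ^ s := by
        rw [Real.mul_rpow hK ha, Real.mul_rpow hK hb]; ring
    _ = _ := by rw [hsplit hK]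

/-- Let `β ∈ (0,1)`. There is `C_β > 0` such that for every
`f ∈ C²_β[0,1]`, `ε ∈ (0,1]`, `k > 0` and `s ∈ [0,1]`,
`|∫_0^ε f(x) exp(ikx) dx| ≤ C_β ε^{1−s} (1/k)^s ‖f‖_{1,β}`. -/
theorem singular_integral_estimate_pos (β : ℝ) (hβ : β ∈ Set.Ioo (0 : ℝ) 1) :
    ∃ C : ℝ, 0 < C ∧
      ∀ f : ℝ → ℂ,
        ContinuousOn f (Set.Icc (0 : ℝ) 1) →
        ContDiffOn ℝ 2 f (Set.Ioc (0 : ℝ) 1) →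
        BddAbove (snormSetPos 2 β f) →
        ∀ ε ∈ Set.Ioc (0 : ℝ) 1, ∀ k : ℝ, 0 < k → ∀ s ∈ Set.Icc (0 : ℝ) 1,
          ‖∫ x in (0 : ℝ)..ε, f x * Complex.exp (Complex.I * k * x)‖ ≤
            C * ε ^ (1 - s) * (1 / k) ^ s * snormPos 1 β f := by
  refine ⟨2 + 1 / β, by have := hβ.1; positivity, fun f hc hf hbdd ε hε k hk s hs => ?_⟩
  have hbdd₁ := hbdd.mono (snormSetPos_mono one_le_two β f)
  set M := snormPos 1 β f
  have hβ₀ : 0 < 1 / β := one_div_pos.2 hβ.1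
  have hbound (x : ℝ) (hx : x ∈ Icc 0 ε) : ‖f x‖ ≤ M :=
    norm_apply_le_snormPos hbdd₁ ⟨hx.1, hx.2.trans hε.2⟩
  have hM : 0 ≤ M := (norm_nonneg _).trans (hbound 0 ⟨le_rfl, hε.1.le⟩)
  have hparts := norm_integral_mul_exp_le_div hβ.1 hε hk hM
    (hc.mono (Icc_subset_Icc_right hε.2))
    (fun x hx => (hf.differentiableOn (by norm_num)).differentiableAt
      (Ioc_mem_nhds hx.1 (hx.2.trans_le hε.2)))
    hbound (fun x hx => norm_deriv_le_snormPos hbdd₁ ⟨hx.1, hx.2.trans_le hε.2⟩)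
  have htriv : ‖∫ x in (0 : ℝ)..ε, f x * Complex.exp (Complex.I * k * x)‖ ≤
      (2 + 1 / β) * M * ε := by
    have h := intervalIntegral.norm_integral_le_of_norm_le_const (a := 0) (b := ε) (C := M)
      (f := fun x : ℝ => f x * Complex.exp (Complex.I * k * x)) fun x hx => by
        rw [uIoc_of_le hε.1.le] at hx
        rw [norm_mul, show Complex.I * k * x = ((k * x : ℝ) : ℂ) * Complex.I by push_cast; ring,
          Complex.norm_exp_ofReal_mul_I, mul_one]
        exact hbound x ⟨hx.1.le, hx.2⟩
    rw [sub_zero, abs_of_pos hε.1] at h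
    refine h.trans (mul_le_mul_of_nonneg_right ?_ hε.1.le)
    exact le_mul_of_one_le_left hM (by linarith)
  refine (le_mul_rpow_mul_rpow (norm_nonneg _) (by positivity) hε.1.le (by positivity) hs
    htriv hparts).trans_eq (by ring)
end

section
/- Let β ∈ (−1,0) ∪ (0,1). There exist constants A_β > 0 and K > 0 such that for all k ≥ K, k^{min{1+β, 1}} · |∫_0^1 x^β exp(ikx) dx| ≥ A_β. -/
open scoped Real

open MeasureTheory Filter Topology Set

lemma continuous_exp_I_mul (k : ℝ) :
    Continuous fun x : ℝ => Complex.exp (Complex.I * k * x) := by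
  fun_prop

lemma intervalIntegrable_rpow_mul_exp {r : ℝ} (hr : -1 < r) (k : ℝ) :
    IntervalIntegrable (fun x : ℝ => ((x ^ r : ℝ) : ℂ) * Complex.exp (Complex.I * k * x))
      volume 0 1 := by
  have h : IntervalIntegrable (fun x : ℝ => x ^ r) volume 0 1 :=
    intervalIntegral.intervalIntegrable_rpow' hr
  exact IntervalIntegrable.mul_continuousOn ⟨h.1.ofReal, h.2.ofReal⟩
    (continuous_exp_I_mul k).continuousOn

/-- A case of the Riemann-Lebesgue lemma. -/
lemma tendsto_integral_rpow_mul_exp (r : ℝ) :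
    Tendsto (fun k : ℝ => ∫ x in (0 : ℝ)..1,
      ((x ^ r : ℝ) : ℂ) * Complex.exp (Complex.I * k * x)) atTop (𝓝 0) := by
  have h := Real.tendsto_integral_exp_smul_cocompact
    ((Ioc (0 : ℝ) 1).indicator fun x : ℝ => ((x ^ r : ℝ) : ℂ))
  have hk : Tendsto (fun k : ℝ => -(k / (2 * π))) atTop (cocompact ℝ) :=
    (tendsto_neg_atTop_atBot.comp (tendsto_id.atTop_div_const (by positivity))).mono_right
      atBot_le_cocompact
  refine (h.comp hk).congr fun k => ?_
  rw [Function.comp_apply, intervalIntegral.integral_of_le zero_le_one,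
    ← integral_indicator measurableSet_Ioc]
  refine integral_congr_ae (Eventually.of_forall fun x => ?_)
  by_cases hx : x ∈ Ioc (0 : ℝ) 1
  · simp only [indicator_of_mem hx, Circle.smul_def, Real.fourierChar_apply, smul_eq_mul]
    rw [mul_comm]
    congr 2
    have : (π : ℂ) ≠ 0 := by exact_mod_cast Real.pi_ne_zero
    push_cast
    field_simp
  · simp [indicator_of_notMem hx]

lemma exp_eq_integral_rpow_mul_exp {β : ℝ} (hβ : 0 < β) (k : ℝ) :
    Complex.exp (Complex.I * k) =
      β * (∫ x in (0 : ℝ)..1, ((x ^ (β - 1) : ℝ) : ℂ) * Complex.exp (Complex.I * k * x)) +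
      Complex.I * k * ∫ x in (0 : ℝ)..1, ((x ^ β : ℝ) : ℂ) * Complex.exp (Complex.I * k * x) := by
  have h₁ := (intervalIntegrable_rpow_mul_exp (r := β - 1) (by linarith) k).const_mul (β : ℂ)
  have h₂ := (intervalIntegrable_rpow_mul_exp (r := β) (by linarith) k).const_mul
    (Complex.I * k)
  rw [← intervalIntegral.integral_const_mul, ← intervalIntegral.integral_const_mul,
    ← intervalIntegral.integral_add h₁ h₂,
    intervalIntegral.integral_eq_sub_of_hasDerivAt_of_le zero_le_one
      (f := fun x : ℝ => ((x ^ β : ℝ) : ℂ) * Complex.exp (Complex.I * k * x)) ?_ ?_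
      (h₁.add h₂)]
  · simp [Real.zero_rpow hβ.ne']
  · exact (Continuous.mul (Complex.continuous_ofReal.comp
      (Real.continuous_rpow_const hβ.le)) (continuous_exp_I_mul k)).continuousOn
  · intro x hx
    have hr := (Real.hasDerivAt_rpow_const (p := β) (Or.inl hx.1.ne')).ofReal_comp
    have he : HasDerivAt (fun x : ℝ => Complex.exp (Complex.I * k * x))
        (Complex.exp (Complex.I * k * x) * (Complex.I * k * 1)) x :=
      ((Complex.ofRealCLM.hasDerivAt (x := x)).const_mul (Complex.I * (k : ℂ))).cexp
    refine (hr.mul he).congr_deriv ?_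
    push_cast
    ring

lemma norm_integral_rpow_mul_exp_ge_of_pos {β : ℝ} (hβ : 0 < β) :
    ∀ᶠ k : ℝ in atTop, 1 / 2 ≤
      k * ‖∫ x in (0 : ℝ)..1, ((x ^ β : ℝ) : ℂ) * Complex.exp (Complex.I * k * x)‖ := by
  have h := ((tendsto_integral_rpow_mul_exp (β - 1)).const_mul (β : ℂ)).norm
  rw [mul_zero, norm_zero] at h
  filter_upwards [h.eventually_le_const (one_half_pos (α := ℝ)), eventually_ge_atTop 0]
    with k hk hk0
  have hn := congrArg norm (exp_eq_integral_rpow_mul_exp hβ k)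
  rw [mul_comm Complex.I, Complex.norm_exp_ofReal_mul_I, mul_comm (k : ℂ)] at hn
  have ht := hn.le.trans (norm_add_le _ _)
  rw [norm_mul (Complex.I * (k : ℂ)), norm_mul Complex.I, Complex.norm_I, one_mul,
    Complex.norm_real, Real.norm_of_nonneg hk0] at ht
  linarith

lemma one_sub_cos_le_abs (x : ℝ) : 1 - Real.cos x ≤ |x| := by
  have h := Real.abs_cos_sub_cos_le 0 x
  rw [Real.cos_zero, zero_sub, abs_neg] at h
  exact (le_abs_self _).trans h

lemma rpow_mul_one_sub_cos_le (r : ℝ) {k x : ℝ} (hk : 0 ≤ k) (hx : 0 < x) :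
    x ^ r * (1 - Real.cos (k * x)) ≤ k * x ^ (r + 1) := by
  have h := one_sub_cos_le_abs (k * x)
  rw [abs_of_nonneg (by positivity)] at h
  calc x ^ r * (1 - Real.cos (k * x)) ≤ x ^ r * (k * x) := by gcongr
    _ = k * x ^ (r + 1) := by rw [Real.rpow_add_one hx.ne']; ring

lemma intervalIntegrable_rpow_mul_one_sub_cos {r : ℝ} (hr : -2 < r) {k : ℝ} (hk : 0 ≤ k) :
    IntervalIntegrable (fun x : ℝ => x ^ r * (1 - Real.cos (k * x))) volume 0 1 := by
  refine ((intervalIntegral.intervalIntegrable_rpow' (r := r + 1) (by linarith)).const_mul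
    k).mono_fun (by fun_prop) ?_
  refine (ae_restrict_mem measurableSet_uIoc).mono fun x hx => ?_
  rw [uIoc_of_le zero_le_one] at hx
  have hx0 := hx.1
  have hc := Real.cos_le_one (k * x)
  beta_reduce
  rw [Real.norm_of_nonneg (mul_nonneg (by positivity) (by linarith)),
    Real.norm_of_nonneg (by positivity)]
  exact rpow_mul_one_sub_cos_le r hk hx0

lemma intervalIntegrable_rpow_mul_sin {r : ℝ} (hr : -1 < r) (k : ℝ) :
    IntervalIntegrable (fun x : ℝ => x ^ r * Real.sin (k * x)) volume 0 1 :=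
  (intervalIntegral.intervalIntegrable_rpow' hr).mul_continuousOn (by fun_prop)

lemma continuousOn_rpow_mul_one_sub_cos {r : ℝ} (hr : -1 < r) (hr0 : r ≠ 0)
    {k : ℝ} (hk : 0 ≤ k) :
    ContinuousOn (fun x : ℝ => x ^ r * (1 - Real.cos (k * x))) (Icc 0 1) := by
  intro x hx
  rcases hx.1.eq_or_lt with rfl | hx0
  · have hlim : Tendsto (fun x : ℝ => k * x ^ (r + 1)) (𝓝[Icc 0 1] 0) (𝓝 0) := by
      have hc : Continuous fun x : ℝ => k * x ^ (r + 1) :=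
        continuous_const.mul (Real.continuous_rpow_const (by linarith))
      have h := hc.tendsto 0
      rw [Real.zero_rpow (by linarith), mul_zero] at h
      exact h.mono_left nhdsWithin_le_nhds
    rw [ContinuousWithinAt, Real.zero_rpow hr0, zero_mul]
    refine squeeze_zero' ?_ ?_ hlim
    · filter_upwards [self_mem_nhdsWithin] with y hy
      exact mul_nonneg (Real.rpow_nonneg hy.1 _) (sub_nonneg.2 (Real.cos_le_one _))
    · filter_upwards [self_mem_nhdsWithin] with y hy
      rcases hy.1.eq_or_lt with rfl | hy0
      · simp [Real.zero_rpow hr0, Real.zero_rpow (show r + 1 ≠ 0 by linarith)]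
      · exact rpow_mul_one_sub_cos_le r hk hy0
  · exact ((Real.continuousAt_rpow_const x r (Or.inl hx0.ne')).mul
      (by fun_prop)).continuousWithinAt

lemma one_sub_cos_eq_integral {β : ℝ} (hβ : -1 < β) (hβ0 : β ≠ 0) {k : ℝ} (hk : 0 ≤ k) :
    1 - Real.cos k = β * (∫ x in (0 : ℝ)..1, x ^ (β - 1) * (1 - Real.cos (k * x))) +
      k * ∫ x in (0 : ℝ)..1, x ^ β * Real.sin (k * x) := by
  have h₁ := (intervalIntegrable_rpow_mul_one_sub_cos (r := β - 1) (by linarith) hk).const_mul β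
  have h₂ := (intervalIntegrable_rpow_mul_sin hβ k).const_mul k
  rw [← intervalIntegral.integral_const_mul, ← intervalIntegral.integral_const_mul,
    ← intervalIntegral.integral_add h₁ h₂,
    intervalIntegral.integral_eq_sub_of_hasDerivAt_of_le zero_le_one
      (continuousOn_rpow_mul_one_sub_cos hβ hβ0 hk) ?_ (h₁.add h₂)]
  · simp
  · intro x hx
    have hr := Real.hasDerivAt_rpow_const (p := β) (Or.inl hx.1.ne')
    have hc : HasDerivAt (fun x : ℝ => 1 - Real.cos (k * x))
        (-(-Real.sin (k * x) * (k * 1))) x :=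
      (((hasDerivAt_id x).const_mul k).cos).const_sub 1
    refine (hr.mul hc).congr_deriv ?_
    ring

lemma integral_rpow_mul_one_sub_cos_ge {r : ℝ} (hr : -2 < r) {k : ℝ} (hk : 1 ≤ k) :
    2 / (π ^ 2 * (r + 3)) * k ^ (-(r + 1)) ≤
      ∫ x in (0 : ℝ)..1, x ^ r * (1 - Real.cos (k * x)) := by
  have hk0 : 0 < k := by linarith
  have hk1 : k⁻¹ ≤ 1 := inv_le_one_of_one_le₀ hk
  have hint := intervalIntegrable_rpow_mul_one_sub_cos hr hk0.le
  have hsub : uIcc 0 k⁻¹ ⊆ uIcc (0 : ℝ) 1 := by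
    rw [uIcc_of_le (by positivity), uIcc_of_le zero_le_one]
    exact Icc_subset_Icc_right hk1
  calc 2 / (π ^ 2 * (r + 3)) * k ^ (-(r + 1))
      = ∫ x in (0 : ℝ)..k⁻¹, 2 / π ^ 2 * k ^ 2 * x ^ (r + 2) := by
        rw [intervalIntegral.integral_const_mul, integral_rpow (Or.inl (by linarith)),
          Real.zero_rpow (by linarith), Real.inv_rpow hk0.le, ← Real.rpow_neg hk0.le,
          show -(r + 1) = 2 + -(r + 2 + 1) by ring, Real.rpow_add hk0, Real.rpow_two]
        have : r + 3 ≠ 0 := by linarith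
        rw [show r + 2 + 1 = r + 3 by ring]
        field_simp
        ring
    _ ≤ ∫ x in (0 : ℝ)..k⁻¹, x ^ r * (1 - Real.cos (k * x)) := by
        refine intervalIntegral.integral_mono_on_of_le_Ioo (by positivity)
          ((intervalIntegral.intervalIntegrable_rpow' (by linarith)).const_mul _)
          (hint.mono_set hsub) fun x hx => ?_
        have hx0 := hx.1
        have hkx : k * x ≤ 1 := by
          rw [← mul_inv_cancel₀ hk0.ne']
          exact mul_le_mul_of_nonneg_left hx.2.le hk0.le
        have hcos := Real.cos_le_one_sub_mul_cos_sq (x := k * x) (by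
          rw [abs_of_nonneg (by positivity)]
          linarith [Real.pi_gt_three])
        calc 2 / π ^ 2 * k ^ 2 * x ^ (r + 2) = x ^ r * (2 / π ^ 2 * (k * x) ^ 2) := by
              rw [Real.rpow_add hx0, Real.rpow_two]; ring
          _ ≤ x ^ r * (1 - Real.cos (k * x)) := by
              gcongr
              linarith
    _ ≤ ∫ x in (0 : ℝ)..1, x ^ r * (1 - Real.cos (k * x)) := by
        refine intervalIntegral.integral_mono_interval le_rfl (by positivity) hk1 ?_ hint
        refine (ae_restrict_mem measurableSet_Ioc).mono fun x hx => ?_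
        exact mul_nonneg (Real.rpow_nonneg hx.1.le _) (sub_nonneg.2 (Real.cos_le_one _))

lemma im_integral_rpow_mul_exp {r : ℝ} (hr : -1 < r) (k : ℝ) :
    (∫ x in (0 : ℝ)..1, ((x ^ r : ℝ) : ℂ) * Complex.exp (Complex.I * k * x)).im =
      ∫ x in (0 : ℝ)..1, x ^ r * Real.sin (k * x) := by
  rw [← Complex.imCLM_apply,
    ← Complex.imCLM.intervalIntegral_comp_comm (intervalIntegrable_rpow_mul_exp hr k)]
  refine intervalIntegral.integral_congr fun x _ => ?_
  simp only [Complex.imCLM_apply, Complex.im_ofReal_mul]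
  rw [show Complex.I * k * x = ((k * x : ℝ) : ℂ) * Complex.I by push_cast; ring,
    Complex.exp_ofReal_mul_I_im]

lemma norm_integral_rpow_mul_exp_ge_of_neg {β : ℝ} (hβ : -1 < β) (hβ0 : β < 0)
    {k : ℝ} (hk : 1 ≤ k) :
    -β * (2 / (π ^ 2 * (β + 2))) ≤ k ^ (1 + β) *
      ‖∫ x in (0 : ℝ)..1, ((x ^ β : ℝ) : ℂ) * Complex.exp (Complex.I * k * x)‖ := by
  have hk0 : 0 < k := by linarith
  have hparts := one_sub_cos_eq_integral hβ hβ0.ne hk0.le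
  have hge := integral_rpow_mul_one_sub_cos_ge (r := β - 1) (by linarith) hk
  rw [show β - 1 + 3 = β + 2 by ring, show -(β - 1 + 1) = -β by ring] at hge
  have hS : -β * (2 / (π ^ 2 * (β + 2)) * k ^ (-β)) ≤
      k * ∫ x in (0 : ℝ)..1, x ^ β * Real.sin (k * x) := by
    have := mul_le_mul_of_nonneg_left hge (neg_nonneg.2 hβ0.le)
    linarith [Real.cos_le_one k]
  calc -β * (2 / (π ^ 2 * (β + 2)))
      = k ^ β * (-β * (2 / (π ^ 2 * (β + 2)) * k ^ (-β))) := by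
        have hkk : k ^ β * k ^ (-β) = 1 := by rw [← Real.rpow_add hk0]; simp
        linear_combination -(-β * (2 / (π ^ 2 * (β + 2)))) * hkk
    _ ≤ k ^ β * (k * ∫ x in (0 : ℝ)..1, x ^ β * Real.sin (k * x)) := by gcongr
    _ = k ^ (1 + β) * ∫ x in (0 : ℝ)..1, x ^ β * Real.sin (k * x) := by
        rw [Real.rpow_add hk0, Real.rpow_one]; ring
    _ ≤ _ := by
        rw [← im_integral_rpow_mul_exp hβ]
        gcongr
        exact (le_abs_self _).trans (Complex.abs_im_le_norm _)

/-- Let `β ∈ (−1,0) ∪ (0,1)`. There are `A_β > 0` and `K > 0` such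
that for all `k ≥ K`, `k^{min{1+β,1}} |∫_0^1 x^β exp(ikx) dx| ≥ A_β`. -/
theorem lower_bound_singular_oscillatory (β : ℝ) (hβ : β ∈ Set.Ioo (-1 : ℝ) 1)
    (hβ0 : β ≠ 0) :
    ∃ A : ℝ, 0 < A ∧ ∃ K : ℝ, 0 < K ∧ ∀ k : ℝ, K ≤ k →
      A ≤ k ^ (min (1 + β) 1) *
        ‖∫ x in (0 : ℝ)..1, ((x ^ β : ℝ) : ℂ) * Complex.exp (Complex.I * k * x)‖ := by
  rcases hβ0.lt_or_gt with hneg | hpos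
  · have h2 : 0 < β + 2 := by linarith [hβ.1]
    refine ⟨-β * (2 / (π ^ 2 * (β + 2))), mul_pos (neg_pos.2 hneg) (by positivity),
      1, one_pos, fun k hk => ?_⟩
    rw [min_eq_left (by linarith)]
    exact norm_integral_rpow_mul_exp_ge_of_neg hβ.1 hneg hk
  · obtain ⟨K, hK⟩ := eventually_atTop.1 (norm_integral_rpow_mul_exp_ge_of_pos hpos)
    refine ⟨1 / 2, one_half_pos, max K 1, by positivity, fun k hk => ?_⟩
    rw [min_eq_right (by linarith), Real.rpow_one]
    exact hK k ((le_max_left _ _).trans hk)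
end

section
/- There exist constants A₀ > 0 and K > 1 such that for all k ≥ K, (k / log k) · |∫_0^1 (log x) exp(ikx) dx| ≥ A₀. -/
open scoped Real

open Set MeasureTheory intervalIntegral

/-- A continuous form of `x ↦ (1 - cos (k x)) / x`. -/
theorem one_sub_cos_div_eq_sin_mul_sinc (k x : ℝ) :
    (1 - Real.cos (k * x)) / x = k * Real.sin (k * x / 2) * Real.sinc (k * x / 2) := by
  rcases eq_or_ne x 0 with rfl | hx
  · simp
  rcases eq_or_ne k 0 with rfl | hk
  · simp
  rw [Real.sinc_of_ne_zero (by positivity)]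
  have h : Real.cos (k * x) = 1 - 2 * Real.sin (k * x / 2) ^ 2 := by
    have h1 := Real.cos_two_mul (k * x / 2)
    rw [mul_div_cancel₀ _ two_ne_zero] at h1
    rw [h1, Real.cos_sq']
    ring
  rw [h]
  field_simp
  ring

theorem continuous_one_sub_cos_div (k : ℝ) :
    Continuous fun x : ℝ => (1 - Real.cos (k * x)) / x := by
  simp_rw [one_sub_cos_div_eq_sin_mul_sinc]
  have := Real.continuous_sinc
  fun_prop

theorem intervalIntegrable_log_mul_sin (k a b : ℝ) :
    IntervalIntegrable (fun x => Real.log x * Real.sin (k * x)) volume a b :=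
  intervalIntegrable_log'.mul_continuousOn (by fun_prop)

theorem integral_log_mul_sin (k : ℝ) :
    k * ∫ x in (0 : ℝ)..1, Real.log x * Real.sin (k * x) =
      -∫ x in (0 : ℝ)..1, (1 - Real.cos (k * x)) / x := by
  have hg := continuous_one_sub_cos_div k
  have hi := (intervalIntegrable_log_mul_sin k 0 1).const_mul k
  have key := integral_eq_sub_of_hasDerivAt_of_le (a := 0) (b := 1)
    (f := fun x => x * Real.log x * ((1 - Real.cos (k * x)) / x))
    (f' := fun x => k * (Real.log x * Real.sin (k * x)) + (1 - Real.cos (k * x)) / x)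
    zero_le_one (Real.continuous_mul_log.mul hg).continuousOn
    (fun x hx => by
      have hx0 : x ≠ 0 := hx.1.ne'
      have h1 : HasDerivAt (fun x => 1 - Real.cos (k * x)) (k * Real.sin (k * x)) x :=
        (((hasDerivAt_id' x).const_mul k).cos.const_sub 1).congr_deriv (by ring)
      have h2 := (Real.hasDerivAt_log hx0).mul h1
      refine (h2.congr_of_eventuallyEq ?_).congr_deriv ?_
      · filter_upwards [isOpen_ne.mem_nhds hx0] with y hy
        have hy' : y ≠ 0 := hy
        change y * Real.log y * ((1 - Real.cos (k * y)) / y) =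
          Real.log y * (1 - Real.cos (k * y))
        field_simp
      · field_simp
        ring)
    (hi.add (hg.intervalIntegrable _ _))
  rw [integral_add hi (hg.intervalIntegrable _ _), intervalIntegral.integral_const_mul] at key
  simp only [Real.log_one, mul_zero, zero_mul, sub_zero] at key
  linarith

theorem integral_cos_mul_div_le {k : ℝ} (hk : 1 ≤ k) :
    ∫ x in k⁻¹..1, Real.cos (k * x) / x ≤ 2 := by
  have hk0 : 0 < k := by linarith
  have hle : k⁻¹ ≤ 1 := inv_le_one_of_one_le₀ hk
  have hne : ∀ x ∈ uIcc k⁻¹ 1, x ≠ 0 := fun x hx => by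
    rw [uIcc_of_le hle] at hx
    exact ((inv_pos.2 hk0).trans_le hx.1).ne'
  have hcos : IntervalIntegrable (fun x => Real.cos (k * x) / x) volume k⁻¹ 1 :=
    ContinuousOn.intervalIntegrable (ContinuousOn.div (by fun_prop) (by fun_prop) hne)
  have hd1 : ∀ x ∈ uIcc k⁻¹ 1, HasDerivAt (fun x => (Real.sin (k * x) - 1) / (k * x))
      (Real.cos (k * x) / x - k⁻¹ * ((Real.sin (k * x) - 1) / x ^ 2)) x := fun x hx => by
    have hx0 := hne x hx
    have h1 := (hasDerivAt_id' x).const_mul k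
    have h2 := (h1.sin.sub_const 1).div h1 (mul_ne_zero hk0.ne' hx0)
    refine h2.congr_deriv ?_
    field_simp
  have hint : IntervalIntegrable (fun x =>
      Real.cos (k * x) / x - k⁻¹ * ((Real.sin (k * x) - 1) / x ^ 2)) volume k⁻¹ 1 :=
    hcos.sub (ContinuousOn.intervalIntegrable (ContinuousOn.mul (by fun_prop)
      (ContinuousOn.div (by fun_prop) (by fun_prop) fun x hx => pow_ne_zero 2 (hne x hx))))
  have h := integral_eq_sub_of_hasDerivAt hd1 hint
  have hmono : ∫ x in k⁻¹..1, Real.cos (k * x) / x ≤ ∫ x in k⁻¹..1,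
      (Real.cos (k * x) / x - k⁻¹ * ((Real.sin (k * x) - 1) / x ^ 2)) :=
    integral_mono_on hle hcos hint fun x _ => by
      have : k⁻¹ * ((Real.sin (k * x) - 1) / x ^ 2) ≤ 0 :=
        mul_nonpos_of_nonneg_of_nonpos (by positivity)
          (div_nonpos_of_nonpos_of_nonneg (by linarith [Real.sin_le_one (k * x)]) (by positivity))
      linarith
  rw [h, mul_one, mul_inv_cancel₀ hk0.ne'] at hmono
  have hb : (Real.sin k - 1) / k ≤ 0 :=
    div_nonpos_of_nonpos_of_nonneg (by linarith [Real.sin_le_one k]) hk0.le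
  linarith [Real.neg_one_le_sin 1]

theorem log_sub_le_integral_one_sub_cos_div {k : ℝ} (hk : 1 ≤ k) :
    Real.log k - 2 ≤ ∫ x in (0 : ℝ)..1, (1 - Real.cos (k * x)) / x := by
  have hk0 : 0 < k := by linarith
  have hle : k⁻¹ ≤ 1 := inv_le_one_of_one_le₀ hk
  have hg := continuous_one_sub_cos_div k
  have hne : ∀ x ∈ uIcc k⁻¹ 1, x ≠ 0 := fun x hx => by
    rw [uIcc_of_le hle] at hx
    exact ((inv_pos.2 hk0).trans_le hx.1).ne'
  have hsplit := integral_add_adjacent_intervals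
    (hg.intervalIntegrable (μ := volume) 0 k⁻¹) (hg.intervalIntegrable k⁻¹ 1)
  have hnonneg : 0 ≤ ∫ x in (0 : ℝ)..k⁻¹, (1 - Real.cos (k * x)) / x :=
    integral_nonneg (by positivity) fun x hx =>
      div_nonneg (by linarith [Real.cos_le_one (k * x)]) hx.1
  have hcos : IntervalIntegrable (fun x => Real.cos (k * x) / x) volume k⁻¹ 1 :=
    ContinuousOn.intervalIntegrable (ContinuousOn.div (by fun_prop) (by fun_prop) hne)
  have hone : IntervalIntegrable (fun x : ℝ => 1 / x) volume k⁻¹ 1 :=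
    ContinuousOn.intervalIntegrable (ContinuousOn.div (by fun_prop) (by fun_prop) hne)
  have hlog : ∫ x in k⁻¹..1, 1 / x = Real.log k := by
    rw [integral_one_div_of_pos (by positivity) one_pos]
    simp
  have hsub : ∫ x in k⁻¹..1, (1 - Real.cos (k * x)) / x =
      Real.log k - ∫ x in k⁻¹..1, Real.cos (k * x) / x := by
    simp_rw [sub_div]
    rw [integral_sub hone hcos, hlog]
  linarith [integral_cos_mul_div_le hk]

/-- There are `A₀ > 0` and `K > 1` such that for all `k ≥ K`,
`(k / log k) |∫_0^1 (log x) exp(ikx) dx| ≥ A₀`. -/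
theorem lower_bound_log_oscillatory :
    ∃ A : ℝ, 0 < A ∧ ∃ K : ℝ, 1 < K ∧ ∀ k : ℝ, K ≤ k →
      A ≤ (k / Real.log k) *
        ‖∫ x in (0 : ℝ)..1, ((Real.log x : ℝ) : ℂ) * Complex.exp (Complex.I * k * x)‖ := by
  refine ⟨1 / 2, by norm_num, Real.exp 4, Real.one_lt_exp_iff.2 (by norm_num), fun k hK => ?_⟩
  have hk : 1 ≤ k := (Real.one_lt_exp_iff.2 (by norm_num : (0 : ℝ) < 4)).le.trans hK
  have hk0 : 0 < k := by linarith
  have hlog : 4 ≤ Real.log k := (Real.le_log_iff_exp_le hk0).2 hK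
  have hint : IntervalIntegrable (fun x : ℝ =>
      ((Real.log x : ℝ) : ℂ) * Complex.exp (Complex.I * k * x)) volume 0 1 := by
    have h : IntervalIntegrable (fun x : ℝ => ((Real.log x : ℝ) : ℂ)) volume 0 1 :=
      ⟨intervalIntegrable_log'.1.ofReal, intervalIntegrable_log'.2.ofReal⟩
    exact h.mul_continuousOn (by fun_prop)
  have him : (∫ x in (0 : ℝ)..1,
      ((Real.log x : ℝ) : ℂ) * Complex.exp (Complex.I * k * x)).im =
      ∫ x in (0 : ℝ)..1, Real.log x * Real.sin (k * x) := by
    rw [← Complex.imCLM_apply, ← Complex.imCLM.intervalIntegral_comp_comm hint]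
    refine integral_congr fun x _ => ?_
    have : Complex.I * k * x = ((k * x : ℝ) : ℂ) * Complex.I := by
      push_cast
      ring
    simp only [Complex.imCLM_apply, this, Complex.im_ofReal_mul, Complex.exp_ofReal_mul_I_im]
  have hnorm := (neg_le_abs _).trans (Complex.abs_im_le_norm (∫ x in (0 : ℝ)..1,
      ((Real.log x : ℝ) : ℂ) * Complex.exp (Complex.I * k * x)))
  have hmul := mul_le_mul_of_nonneg_left hnorm hk0.le
  rw [him] at hmul
  rw [div_mul_eq_mul_div, le_div_iff₀ (by linarith)]
  linarith [integral_log_mul_sin k, log_sub_le_integral_one_sub_cos_div hk]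
end

section
/- Let ξ < b be real, let n ≥ 1 be an integer, and let f, g ∈ C^∞[ξ,b] with g'(ξ) = g''(ξ) = … = g^{(n)}(ξ) = 0, g^{(n+1)}(ξ) > 0 and g'(x) > 0 for x ∈ (ξ,b]. Let G : [g(ξ), g(b)] → [ξ,b] be the inverse of g on [ξ,b], set α := 1/(n+1) and F(τ) := f(G(τ)) · G'(τ) for τ ∈ (g(ξ), g(b)]. Then for every integer p ≥ 0 there exists a constant C_p > 0 such that |F^{(p)}(τ)| ≤ C_p (τ − g(ξ))^{α − p − 1} for all τ ∈ (g(ξ), g(b)]. -/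
open scoped Real

/-- `u` is smooth on `[a, b]` and its derivatives of order less than `k` vanish at `a`. -/
structure VanishesToOrder {E : Type*} [NormedAddCommGroup E] [NormedSpace ℝ E]
    (a b : ℝ) (k : ℕ) (u : ℝ → E) : Prop where
  contDiffOn : ContDiffOn ℝ (⊤ : ℕ∞) u (Set.Icc a b)
  iteratedDerivWithin_eq_zero : ∀ j < k, iteratedDerivWithin j u (Set.Icc a b) a = 0

namespace VanishesToOrder

variable {E : Type*} [NormedAddCommGroup E] [NormedSpace ℝ E] {a b : ℝ} {k l : ℕ}
  {u v : ℝ → E}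

lemma mono (h : VanishesToOrder a b l u) (hkl : k ≤ l) : VanishesToOrder a b k u :=
  ⟨h.contDiffOn, fun j hj => h.iteratedDerivWithin_eq_zero j (hj.trans_le hkl)⟩

lemma differentiableOn (h : VanishesToOrder a b k u) : DifferentiableOn ℝ u (Set.Icc a b) :=
  h.contDiffOn.differentiableOn (by simp)

lemma hasDerivWithinAt (h : VanishesToOrder a b k u) {x : ℝ} (hx : x ∈ Set.Icc a b) :
    HasDerivWithinAt u (derivWithin u (Set.Icc a b) x) (Set.Icc a b) x :=
  (h.differentiableOn x hx).hasDerivWithinAt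

lemma hasDerivWithinAt_Ici (h : VanishesToOrder a b k u) {x : ℝ} (hx : x ∈ Set.Ico a b) :
    HasDerivWithinAt u (derivWithin u (Set.Icc a b) x) (Set.Ici x) x :=
  (h.hasDerivWithinAt ⟨hx.1, hx.2.le⟩).mono_of_mem_nhdsWithin
    (Filter.mem_of_superset (Icc_mem_nhdsGE hx.2) (Set.Icc_subset_Icc_left hx.1))

lemma derivWithin (hab : a < b) (h : VanishesToOrder a b k u) :
    VanishesToOrder a b (k - 1) (derivWithin u (Set.Icc a b)) := by
  refine ⟨((contDiffOn_infty_iff_derivWithin (uniqueDiffOn_Icc hab)).1 h.contDiffOn).2,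
    fun j hj => ?_⟩
  rw [← iteratedDerivWithin_succ']
  exact h.iteratedDerivWithin_eq_zero _ (by omega)

lemma of_derivWithin (hu : ContDiffOn ℝ (⊤ : ℕ∞) u (Set.Icc a b)) (h0 : u a = 0)
    (h : VanishesToOrder a b k (_root_.derivWithin u (Set.Icc a b))) :
    VanishesToOrder a b (k + 1) u := by
  refine ⟨hu, fun j hj => ?_⟩
  cases j with
  | zero => simpa using h0
  | succ j =>
    rw [iteratedDerivWithin_succ']
    exact h.iteratedDerivWithin_eq_zero _ (by omega)

lemma apply_left (h : VanishesToOrder a b k u) (hk : 0 < k) : u a = 0 := by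
  simpa using h.iteratedDerivWithin_eq_zero 0 hk

lemma congr (h : VanishesToOrder a b k u) (hab : a ≤ b) (huv : Set.EqOn v u (Set.Icc a b)) :
    VanishesToOrder a b k v := by
  refine ⟨h.contDiffOn.congr huv, fun j hj => ?_⟩
  rw [iteratedDerivWithin_congr huv (Set.left_mem_Icc.2 hab)]
  exact h.iteratedDerivWithin_eq_zero j hj

lemma add (hab : a < b) (hu : VanishesToOrder a b k u) (hv : VanishesToOrder a b k v) :
    VanishesToOrder a b k (fun x => u x + v x) := by
  induction k generalizing u v with
  | zero => exact ⟨hu.contDiffOn.add hv.contDiffOn, by simp⟩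
  | succ k ih =>
    refine of_derivWithin (hu.contDiffOn.add hv.contDiffOn)
      (by simp [hu.apply_left, hv.apply_left]) ?_
    refine (ih (hu.derivWithin hab) (hv.derivWithin hab)).congr hab.le fun x hx => ?_
    exact derivWithin_fun_add (hu.differentiableOn x hx) (hv.differentiableOn x hx)

lemma smul (hab : a < b) {c : ℝ → ℝ} (hc : VanishesToOrder a b k c)
    (hu : VanishesToOrder a b l u) : VanishesToOrder a b (k + l) (fun x => c x • u x) := by
  obtain ⟨m, hm⟩ : ∃ m, m = k + l := ⟨_, rfl⟩
  rw [← hm]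
  induction m generalizing k l c u with
  | zero => exact ⟨hc.contDiffOn.smul hu.contDiffOn, by simp⟩
  | succ m ih =>
    refine of_derivWithin (hc.contDiffOn.smul hu.contDiffOn) ?_ ?_
    · rcases Nat.eq_zero_or_pos k with hk | hk
      · simp [hu.apply_left (by omega)]
      · simp [hc.apply_left hk]
    · have key : VanishesToOrder a b m (fun x => c x • _root_.derivWithin u (Set.Icc a b) x
          + _root_.derivWithin c (Set.Icc a b) x • u x) := by
        refine add hab ?_ ?_
        · rcases Nat.eq_zero_or_pos l with hl | hl
          · exact ih (hc.mono (k := m) (by omega)) ((hu.derivWithin hab).mono (Nat.zero_le _))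
              (by omega)
          · exact ih hc (hu.derivWithin hab) (by omega)
        · rcases Nat.eq_zero_or_pos k with hk | hk
          · exact ih ((hc.derivWithin hab).mono (Nat.zero_le _)) (hu.mono (k := m) (by omega))
              (by omega)
          · exact ih (hc.derivWithin hab) hu (by omega)
      refine key.congr hab.le fun x hx => ?_
      exact derivWithin_fun_smul (hc.differentiableOn x hx) (hu.differentiableOn x hx)

lemma const_smul (h : VanishesToOrder a b k u) (hab : a < b) (r : ℝ) :
    VanishesToOrder a b k (fun x => r • u x) := by
  have hr : VanishesToOrder a b 0 (fun _ : ℝ => r) := ⟨contDiffOn_const, by simp⟩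
  simpa using hr.smul hab h

lemma exists_norm_le (hab : a < b) (h : VanishesToOrder a b k u) :
    ∃ C, 0 < C ∧ ∀ x ∈ Set.Icc a b, ‖u x‖ ≤ C * (x - a) ^ k := by
  induction k generalizing u with
  | zero =>
    obtain ⟨C, hC⟩ := isCompact_Icc.exists_bound_of_continuousOn h.contDiffOn.continuousOn
    exact ⟨max C 1, by positivity, fun x hx => by simpa using Or.inl (hC x hx)⟩
  | succ k ih =>
    obtain ⟨C, hC, hu⟩ := ih (h.derivWithin hab)
    refine ⟨C, hC, fun x hx => ?_⟩
    have hx0 : 0 ≤ x - a := sub_nonneg.2 hx.1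
    have hax : Set.Icc a x ⊆ Set.Icc a b := Set.Icc_subset_Icc_right hx.2
    have := norm_image_sub_le_of_norm_deriv_le_segment' (f := u) (C := C * (x - a) ^ k)
      (fun y hy => (h.hasDerivWithinAt (hax hy)).mono hax)
      (fun y hy => (hu y (hax ⟨hy.1, hy.2.le⟩)).trans (by
        have : 0 ≤ y - a := sub_nonneg.2 hy.1
        gcongr
        exact hy.2.le)) x ⟨hx.1, le_rfl⟩
    rw [h.apply_left k.succ_pos, sub_zero] at this
    rwa [pow_succ, ← mul_assoc]

lemma exists_le_nhds {w : ℝ → ℝ} (hab : a < b) (h : VanishesToOrder a b k w)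
    (hpos : 0 < iteratedDerivWithin k w (Set.Icc a b) a) :
    ∃ d ∈ Set.Ioc a b, ∃ c, 0 < c ∧ ∀ x ∈ Set.Icc a d, c * (x - a) ^ k ≤ w x := by
  induction k generalizing w with
  | zero =>
    rw [iteratedDerivWithin_zero] at hpos
    have hev : ∀ᶠ x in nhdsWithin a (Set.Icc a b), w a / 2 < w x :=
      (h.contDiffOn.continuousOn a (Set.left_mem_Icc.2 hab.le)).eventually
        (lt_mem_nhds (half_lt_self hpos))
    rw [nhdsWithin_Icc_eq_nhdsGE hab] at hev
    obtain ⟨d, hd, hd'⟩ := (mem_nhdsGE_iff_exists_Icc_subset).1 hev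
    refine ⟨min d b, ⟨lt_min hd hab, min_le_right _ _⟩, w a / 2, half_pos hpos, fun x hx => ?_⟩
    simpa using (hd' ⟨hx.1, hx.2.trans (min_le_left _ _)⟩).le
  | succ k ih =>
    rw [iteratedDerivWithin_succ'] at hpos
    obtain ⟨d, hd, c, hc, hw⟩ := ih (h.derivWithin hab) hpos
    refine ⟨d, hd, c / (k + 1), by positivity, ?_⟩
    have hB : ∀ x, HasDerivAt (fun x => c / (k + 1) * (x - a) ^ (k + 1)) (c * (x - a) ^ k) x := by
      intro x
      refine (((hasDerivAt_id x).sub_const a).fun_pow (k + 1) |>.const_mul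
        (c / (k + 1 : ℝ))).congr_deriv ?_
      simp only [Nat.cast_add, Nat.cast_one, Nat.add_sub_cancel, id, mul_one]
      field_simp
    refine image_le_of_deriv_right_le_deriv_boundary
      (fun x _ => (hB x).continuousAt.continuousWithinAt)
      (fun x _ => (hB x).hasDerivWithinAt) ?_
      (h.contDiffOn.continuousOn.mono (Set.Icc_subset_Icc_right hd.2))
      (fun x hx => h.hasDerivWithinAt_Ici ⟨hx.1, hx.2.trans_le hd.2⟩)
      (fun x hx => hw x ⟨hx.1, hx.2.le⟩)
    simp [h.apply_left k.succ_pos]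

lemma exists_le {w : ℝ → ℝ} (hab : a < b) (h : VanishesToOrder a b k w)
    (hpos : 0 < iteratedDerivWithin k w (Set.Icc a b) a) (hw : ∀ x ∈ Set.Ioc a b, 0 < w x) :
    ∃ c, 0 < c ∧ ∀ x ∈ Set.Icc a b, c * (x - a) ^ k ≤ w x := by
  obtain ⟨d, hd, c, hc, hcw⟩ := h.exists_le_nhds hab hpos
  obtain ⟨y, hy, hmin⟩ := (isCompact_Icc (a := d) (b := b)).exists_isMinOn
    (Set.nonempty_Icc.2 hd.2) (h.contDiffOn.continuousOn.mono (Set.Icc_subset_Icc_left hd.1.le))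
  have hwy := hw y ⟨hd.1.trans_le hy.1, hy.2⟩
  have hba : 0 < b - a := sub_pos.2 hab
  refine ⟨min c (w y / (b - a) ^ k), by positivity, fun x hx => ?_⟩
  have hxa : 0 ≤ x - a := sub_nonneg.2 hx.1
  rcases le_total x d with hxd | hxd
  · exact (mul_le_mul_of_nonneg_right (min_le_left _ _) (by positivity)).trans (hcw x ⟨hx.1, hxd⟩)
  · calc min c (w y / (b - a) ^ k) * (x - a) ^ k
        ≤ w y / (b - a) ^ k * (b - a) ^ k := by
          gcongr
          · exact min_le_right _ _
          · exact hx.2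
      _ = w y := by field_simp
      _ ≤ w x := hmin ⟨hxd, hx.2⟩

end VanishesToOrder

/-- The derivative of `(w ^ (2 p + 1))⁻¹ • h` divided by `w` is again of this shape, with `p + 1`
in place of `p`. -/
lemma hasDerivWithinAt_inv_pow_smul_comp {E : Type*} [NormedAddCommGroup E] [NormedSpace ℝ E]
    {w G : ℝ → ℝ} {h : ℝ → E} {S T : Set ℝ} {τ w' : ℝ} {h' : E} (p : ℕ) (hw0 : w (G τ) ≠ 0)
    (hw : HasDerivWithinAt w w' S (G τ)) (hh : HasDerivWithinAt h h' S (G τ))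
    (hG : HasDerivWithinAt G (w (G τ))⁻¹ T τ) (hmaps : Set.MapsTo G T S) :
    HasDerivWithinAt (fun t => (w (G t) ^ (2 * p + 1))⁻¹ • h (G t))
      ((w (G τ) ^ (2 * (p + 1) + 1))⁻¹ •
        (w (G τ) • h' + (-(2 * p + 1 : ℝ)) • w' • h (G τ))) T τ := by
  have h1 := ((hw.pow (2 * p + 1)).inv (pow_ne_zero _ hw0)).smul hh
  have h2 := HasDerivWithinAt.scomp τ h1 hG hmaps
  refine (h2.congr_deriv ?_)
  simp only [smul_add, smul_smul, Pi.pow_apply, Pi.inv_apply]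
  congr 2
  · field_simp
    ring
  · push_cast
    field_simp
    ring

lemma continuousOn_of_inverse_on_isCompact {S T : Set ℝ} {g G : ℝ → ℝ} (hS : IsCompact S)
    (hg : ContinuousOn g S) (himg : g '' S = T) (hGg : ∀ x ∈ S, G (g x) = x) :
    ContinuousOn G T := by
  refine continuousOn_iff_isClosed.2 fun t ht => ⟨g '' (S ∩ t), ?_, ?_⟩
  · exact ((hS.inter_right ht).image_of_continuousOn (hg.mono Set.inter_subset_left)).isClosed
  · subst himg
    ext y
    constructor
    · rintro ⟨hy, x, hx, rfl⟩
      rw [Set.mem_preimage, hGg x hx] at hy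
      exact ⟨⟨x, ⟨hx, hy⟩, rfl⟩, x, hx, rfl⟩
    · rintro ⟨⟨x, ⟨hx, hxt⟩, rfl⟩, hy⟩
      exact ⟨by rwa [Set.mem_preimage, hGg x hx], hy⟩

lemma HasDerivWithinAt.of_inverse_on {S T : Set ℝ} {g G : ℝ → ℝ} {g' τ : ℝ}
    (hG : ContinuousWithinAt G T τ) (hmaps : Set.MapsTo G T S) (hτ : τ ∈ T)
    (hg : HasDerivWithinAt g g' S (G τ)) (hg' : g' ≠ 0) (hgG : ∀ t ∈ T, g (G t) = t) :
    HasDerivWithinAt G g'⁻¹ T τ := by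
  have h : HasFDerivWithinAt g
      (ContinuousLinearEquiv.unitsEquivAut ℝ (Units.mk0 g' hg') : ℝ →L[ℝ] ℝ) S (G τ) := by
    refine hg.hasFDerivWithinAt.congr_fderiv ?_
    ext
    simp
  have := h.of_local_left_inverse (g := G) (s := T)
    (tendsto_nhdsWithin_iff.2 ⟨hG, eventually_nhdsWithin_of_forall hmaps⟩) hτ
    (eventually_nhdsWithin_of_forall hgG)
  simpa using this.hasDerivWithinAt

/-- Let `ξ < b`, `n ≥ 1`, `f, g ∈ C^∞[ξ,b]`, where `g` has a stationary
point of order `n` at `ξ` (`g'(ξ) = … = g^{(n)}(ξ) = 0`, `g^{(n+1)}(ξ) > 0`) and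
`g' > 0` on `(ξ,b]`.  Let `G` be the inverse of `g` on `[ξ,b]`, `α = 1/(n+1)` and
`F(τ) = f(G(τ)) G'(τ)`.  Then for every `p ≥ 0` there is `C_p > 0` with
`|F^{(p)}(τ)| ≤ C_p (τ − g(ξ))^{α−p−1}` for all `τ ∈ (g(ξ), g(b)]`. -/
theorem transplanted_amplitude_derivative_estimate (ξ b : ℝ) (hξb : ξ < b)
    (n : ℕ) (hn : 1 ≤ n) (f : ℝ → ℂ) (g G : ℝ → ℝ)
    (hf : ContDiffOn ℝ (⊤ : ℕ∞) f (Set.Icc ξ b))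
    (hg : ContDiffOn ℝ (⊤ : ℕ∞) g (Set.Icc ξ b))
    (hstat : ∀ j : ℕ, 1 ≤ j → j ≤ n → iteratedDerivWithin j g (Set.Icc ξ b) ξ = 0)
    (hpos : 0 < iteratedDerivWithin (n + 1) g (Set.Icc ξ b) ξ)
    (hg' : ∀ x ∈ Set.Ioc ξ b, 0 < derivWithin g (Set.Icc ξ b) x)
    (hGg : ∀ x ∈ Set.Icc ξ b, G (g x) = x)
    (hgG : ∀ τ ∈ Set.Icc (g ξ) (g b), g (G τ) = τ)
    (F : ℝ → ℂ)
    (hF : ∀ τ, F τ = f (G τ) * ((derivWithin G (Set.Icc (g ξ) (g b)) τ : ℝ) : ℂ)) :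
    ∀ p : ℕ, ∃ C : ℝ, 0 < C ∧
      ∀ τ ∈ Set.Ioc (g ξ) (g b),
        ‖iteratedDerivWithin p F (Set.Icc (g ξ) (g b)) τ‖ ≤
          C * (τ - g ξ) ^ ((1 : ℝ) / ((n : ℝ) + 1) - (p : ℝ) - 1) := by
  set S := Set.Icc ξ b
  set T := Set.Icc (g ξ) (g b)
  have hUS : UniqueDiffOn ℝ S := uniqueDiffOn_Icc hξb
  have hξS : ξ ∈ S := Set.left_mem_Icc.2 hξb.le
  have hbS : b ∈ S := Set.right_mem_Icc.2 hξb.le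
  set w := derivWithin g S with hw
  have hgd : ∀ x ∈ S, HasDerivWithinAt g (w x) S x := fun x hx =>
    (hg.differentiableOn (by simp) x hx).hasDerivWithinAt
  have hmono : StrictMonoOn g S := by
    refine strictMonoOn_of_deriv_pos (convex_Icc _ _) hg.continuousOn fun x hx => ?_
    rw [interior_Icc] at hx
    rw [← derivWithin_of_mem_nhds (Icc_mem_nhds hx.1 hx.2)]
    exact hg' x ⟨hx.1, hx.2.le⟩
  have hgξb : g ξ < g b := hmono hξS hbS hξb
  have hUT : UniqueDiffOn ℝ T := uniqueDiffOn_Icc hgξb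
  have himg : g '' S = T := hg.continuousOn.image_Icc_of_monotoneOn hξb.le hmono.monotoneOn
  have hmaps : Set.MapsTo G T S := by
    rw [← himg]
    rintro _ ⟨x, hx, rfl⟩
    rwa [hGg x hx]
  have hGcont : ContinuousOn G T :=
    continuousOn_of_inverse_on_isCompact isCompact_Icc hg.continuousOn himg hGg
  have hGIoc : ∀ τ ∈ Set.Ioc (g ξ) (g b), G τ ∈ Set.Ioc ξ b := fun τ hτ => by
    have hτT : τ ∈ T := ⟨hτ.1.le, hτ.2⟩
    have h := hmaps hτT
    refine ⟨lt_of_le_of_ne h.1 fun heq => hτ.1.ne ?_, h.2⟩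
    rw [heq, hgG τ hτT]
  have hGd : ∀ τ ∈ Set.Ioc (g ξ) (g b), HasDerivWithinAt G (w (G τ))⁻¹ T τ := fun τ hτ => by
    have hτT : τ ∈ T := ⟨hτ.1.le, hτ.2⟩
    exact .of_inverse_on (hGcont τ hτT) hmaps hτT (hgd _ (hmaps hτT)) (hg' _ (hGIoc τ hτ)).ne' hgG
  obtain ⟨m, rfl⟩ : ∃ m, n = m + 1 := ⟨n - 1, by omega⟩
  have hgvan : VanishesToOrder ξ b (m + 1) w := by
    refine ⟨((contDiffOn_infty_iff_derivWithin hUS).1 hg).2, fun j hj => ?_⟩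
    rw [hw, ← iteratedDerivWithin_succ']
    exact hstat _ (by omega) (by omega)
  have hsubvan : VanishesToOrder ξ b (m + 1 + 1) (fun x => g x - g ξ) := by
    refine .of_derivWithin (hg.sub contDiffOn_const) (sub_self _) ?_
    exact hgvan.congr hξb.le fun x hx => derivWithin_sub_const _
  have hF_formula : ∀ p : ℕ, ∃ h : ℝ → ℂ, VanishesToOrder ξ b (m * p) h ∧
      ∀ τ ∈ Set.Ioc (g ξ) (g b),
        iteratedDerivWithin p F T τ = (w (G τ) ^ (2 * p + 1))⁻¹ • h (G τ) := by
    intro p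
    induction p with
    | zero =>
      refine ⟨f, ⟨hf, by simp⟩, fun τ hτ => ?_⟩
      have hτT : τ ∈ T := ⟨hτ.1.le, hτ.2⟩
      rw [iteratedDerivWithin_zero, hF, (hGd τ hτ).derivWithin (hUT τ hτT)]
      simp [mul_comm]
    | succ p ih =>
      obtain ⟨h, hh, hFh⟩ := ih
      refine ⟨fun x => w x • derivWithin h S x + (-(2 * p + 1 : ℝ)) • derivWithin w S x • h x,
        ?_, fun τ hτ => ?_⟩
      · refine .add hξb ?_ (.const_smul ?_ hξb _)
        · refine (hgvan.smul hξb (hh.derivWithin hξb)).mono ?_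
          rw [Nat.mul_succ]
          omega
        · refine ((hgvan.derivWithin hξb).smul hξb hh).mono ?_
          rw [Nat.mul_succ]
          omega
      · have hτT : τ ∈ T := ⟨hτ.1.le, hτ.2⟩
        have hev : iteratedDerivWithin p F T =ᶠ[nhdsWithin τ T]
            fun t => (w (G t) ^ (2 * p + 1))⁻¹ • h (G t) := by
          filter_upwards [self_mem_nhdsWithin, nhdsWithin_le_nhds (lt_mem_nhds hτ.1)] with t ht ht'
          exact hFh t ⟨ht', ht.2⟩
        rw [iteratedDerivWithin_succ, hev.derivWithin_eq (hFh τ hτ)]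
        exact (hasDerivWithinAt_inv_pow_smul_comp p (hg' _ (hGIoc τ hτ)).ne'
          (hgvan.hasDerivWithinAt (hmaps hτT)) (hh.hasDerivWithinAt (hmaps hτT)) (hGd τ hτ)
          hmaps).derivWithin (hUT τ hτT)
  obtain ⟨c, hc, hcw⟩ := hgvan.exists_le hξb (by rwa [hw, ← iteratedDerivWithin_succ']) hg'
  obtain ⟨D, hD, hDg⟩ := hsubvan.exists_norm_le hξb
  intro p
  obtain ⟨h, hh, hFh⟩ := hF_formula p
  obtain ⟨C, hC, hCh⟩ := hh.exists_norm_le hξb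
  set r : ℝ := 1 / (((m + 1 : ℕ) : ℝ) + 1) - (p : ℝ) - 1 with hr
  have hr0 : r ≤ 0 := by
    have : 1 / (((m + 1 : ℕ) : ℝ) + 1) ≤ 1 :=
      div_le_one_of_le₀ (by linarith [Nat.cast_nonneg (α := ℝ) (m + 1)]) (by positivity)
    linarith [Nat.cast_nonneg (α := ℝ) p]
  refine ⟨C / c ^ (2 * p + 1) * D ^ (-r), by positivity, fun τ hτ => ?_⟩
  have hx := hGIoc τ hτ
  have hxS : G τ ∈ S := Set.Ioc_subset_Icc_self hx
  have hτT : τ ∈ T := ⟨hτ.1.le, hτ.2⟩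
  set y := G τ - ξ
  have hy0 : 0 < y := sub_pos.2 hx.1
  have hτ0 : 0 < τ - g ξ := sub_pos.2 hτ.1
  have hτy : τ - g ξ ≤ D * y ^ (m + 1 + 1) := by
    have := hDg _ hxS
    rw [hgG τ hτT] at this
    exact (le_abs_self _).trans this
  have hpow : y ^ (m * p) / (y ^ (m + 1)) ^ (2 * p + 1) = (y ^ (m + 1 + 1)) ^ r := by
    rw [← pow_mul, ← Real.rpow_natCast, ← Real.rpow_natCast, ← Real.rpow_natCast,
      ← Real.rpow_sub hy0, ← Real.rpow_mul hy0.le]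
    congr 1
    rw [hr]
    push_cast
    field_simp
    ring
  rw [hFh τ hτ, norm_smul, norm_inv, norm_pow, Real.norm_of_nonneg (hg' _ hx).le,
    inv_mul_eq_div]
  calc ‖h (G τ)‖ / w (G τ) ^ (2 * p + 1)
      ≤ C * y ^ (m * p) / (c * y ^ (m + 1)) ^ (2 * p + 1) := by
        gcongr
        · exact hCh _ hxS
        · exact hcw _ hxS
    _ = C / c ^ (2 * p + 1) * (y ^ (m * p) / (y ^ (m + 1)) ^ (2 * p + 1)) := by
        rw [mul_pow]
        field_simp
    _ = C / c ^ (2 * p + 1) * D ^ (-r) * (D * y ^ (m + 1 + 1)) ^ r := by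
        rw [hpow, Real.mul_rpow hD.le (by positivity), mul_assoc, ← mul_assoc (D ^ (-r)),
          ← Real.rpow_add hD, neg_add_cancel, Real.rpow_zero, one_mul]
    _ ≤ C / c ^ (2 * p + 1) * D ^ (-r) * (τ - g ξ) ^ r := by
        gcongr ?_ * ?_
        exact Real.rpow_le_rpow_of_nonpos hτ0 hτy hr0
end

section
/- Let β ∈ (0,1), let f ∈ C¹_β[0,1] and let 0 < x₁ ≤ 1. Let Q₁f denote the linear function interpolating (0, f(0)) and (x₁, f(x₁)). Then the (constant) slope of Q₁f satisfies |(Q₁f)'| = |f(x₁) − f(0)|/x₁ ≤ (1/β) x₁^{β−1} ‖f‖_{1,β}, and for every t ∈ [0, x₁], |f(t) − (Q₁f)(t)| ≤ (2/β) x₁^{β} ‖f‖_{1,β}. -/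
open scoped Real

/-- A function in `C¹_β[0,1]` is Hölder continuous at the origin. -/
theorem norm_sub_zero_le_snormPos {β : ℝ} (hβ : 0 < β) {f : ℝ → ℂ}
    (hcont : ContinuousOn f (Set.Icc (0 : ℝ) 1))
    (hdiff : DifferentiableOn ℝ f (Set.Ioc (0 : ℝ) 1))
    (hbdd : BddAbove (snormSetPos 1 β f)) {t : ℝ} (ht : 0 < t) (ht' : t ≤ 1) :
    ‖f t - f 0‖ ≤ 1 / β * t ^ β * snormPos 1 β f := by
  have hderiv : ∀ x ∈ Set.Ioc (0 : ℝ) 1,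
      ‖derivWithin f (Set.Ioc (0 : ℝ) 1) x‖ ≤ snormPos 1 β f / β * (β * x ^ (β - 1)) := by
    intro x hx
    have h : x ^ (1 - β) * ‖derivWithin f (Set.Ioc (0 : ℝ) 1) x‖ ≤ snormPos 1 β f :=
      le_csSup hbdd (Or.inr ⟨1, le_rfl, le_rfl, x, hx, by simp [iteratedDerivWithin_one]⟩)
    rw [← neg_sub, Real.rpow_neg hx.1.le] at h
    have hpos : 0 < x ^ (β - 1) := Real.rpow_pos_of_pos hx.1 _
    rw [inv_mul_le_iff₀ hpos] at h
    calc _ ≤ _ := h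
      _ = _ := by field_simp
  have hnonneg : 0 ≤ snormPos 1 β f :=
    (norm_nonneg (f 0)).trans (le_csSup hbdd (Or.inl ⟨0, by simp, rfl⟩))
  have hstep : ∀ s ∈ Set.Ioo 0 t, ‖f t - f s‖ ≤ 1 / β * t ^ β * snormPos 1 β f := by
    intro s hs
    have hsub : Set.Icc s t ⊆ Set.Icc 0 1 := Set.Icc_subset_Icc hs.1.le ht'
    have hB : ∀ x ∈ Set.Icc s t, HasDerivAt
        (fun y => snormPos 1 β f / β * (y ^ β - s ^ β))
        (snormPos 1 β f / β * (β * x ^ (β - 1))) x := fun x hx =>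
      ((Real.hasDerivAt_rpow_const (Or.inl (hs.1.trans_le hx.1).ne')).sub_const _).const_mul _
    have h := image_norm_le_of_norm_deriv_right_le_deriv_boundary'
      (f := fun x => f x - f s) (f' := derivWithin f (Set.Ioc (0 : ℝ) 1))
      ((hcont.mono hsub).sub continuousOn_const)
      (fun x hx => by
        have hx0 : 0 < x := hs.1.trans_le hx.1
        have hx1 : x < 1 := hx.2.trans_le ht'
        refine ((hdiff x ⟨hx0, hx1.le⟩).hasDerivWithinAt.mono_of_mem_nhdsWithin ?_).sub_const _
        exact Filter.mem_of_superset (Icc_mem_nhdsGE hx1)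
          fun y hy => ⟨hx0.trans_le hy.1, hy.2⟩)
      (by simp)
      (fun x hx => (hB x hx).continuousAt.continuousWithinAt)
      (fun x hx => (hB x ⟨hx.1, hx.2.le⟩).hasDerivWithinAt)
      (fun x hx => hderiv x ⟨hs.1.trans_le hx.1, hx.2.le.trans ht'⟩)
      (Set.right_mem_Icc.2 hs.2.le)
    calc ‖f t - f s‖ ≤ snormPos 1 β f / β * (t ^ β - s ^ β) := h
      _ ≤ snormPos 1 β f / β * t ^ β := by
        gcongr
        exact sub_le_self _ (Real.rpow_nonneg hs.1.le _)
      _ = _ := by ring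
  have hlim : Filter.Tendsto f (nhdsWithin 0 (Set.Ioo 0 t)) (nhds (f 0)) :=
    (hcont 0 (by simp)).mono fun y hy => ⟨hy.1.le, hy.2.le.trans ht'⟩
  have : (nhdsWithin (0 : ℝ) (Set.Ioo 0 t)).NeBot := left_nhdsWithin_Ioo_neBot ht
  exact le_of_tendsto (tendsto_const_nhds.sub hlim).norm
    (eventually_nhdsWithin_of_forall hstep)

/-- Let `β ∈ (0,1)`, `f ∈ C¹_β[0,1]` and `0 < x₁ ≤ 1`.  With `Q₁f` the
linear interpolant of `(0,f(0))` and `(x₁,f(x₁))`, its slope satisfies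
`|f(x₁) − f(0)|/x₁ ≤ (1/β) x₁^{β−1} ‖f‖_{1,β}`, and for every `t ∈ [0,x₁]`,
`|f(t) − (Q₁f)(t)| ≤ (2/β) x₁^β ‖f‖_{1,β}`. -/
theorem linear_interpolant_estimates (β : ℝ) (hβ : β ∈ Set.Ioo (0 : ℝ) 1)
    (f : ℝ → ℂ)
    (hcont : ContinuousOn f (Set.Icc (0 : ℝ) 1))
    (hdiff : ContDiffOn ℝ 1 f (Set.Ioc (0 : ℝ) 1))
    (hbdd : BddAbove (snormSetPos 1 β f))
    (x₁ : ℝ) (hx₁ : 0 < x₁) (hx₁' : x₁ ≤ 1) :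
    ‖f x₁ - f 0‖ / x₁ ≤ (1 / β) * x₁ ^ (β - 1) * snormPos 1 β f ∧
      ∀ t ∈ Set.Icc (0 : ℝ) x₁,
        ‖f t - (f 0 + (f x₁ - f 0) / (x₁ : ℂ) * (t : ℂ))‖ ≤
          (2 / β) * x₁ ^ β * snormPos 1 β f := by
  obtain ⟨hβ0, hβ1⟩ := hβ
  have hdiff' := hdiff.differentiableOn one_ne_zero
  have hnonneg : 0 ≤ snormPos 1 β f :=
    (norm_nonneg (f 0)).trans (le_csSup hbdd (Or.inl ⟨0, by simp, rfl⟩))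
  have hx := norm_sub_zero_le_snormPos hβ0 hcont hdiff' hbdd hx₁ hx₁'
  refine ⟨?_, fun t ht => ?_⟩
  · rw [Real.rpow_sub_one hx₁.ne']
    calc ‖f x₁ - f 0‖ / x₁ ≤ 1 / β * x₁ ^ β * snormPos 1 β f / x₁ := by gcongr
      _ = _ := by ring
  · have hft : ‖f t - f 0‖ ≤ 1 / β * x₁ ^ β * snormPos 1 β f := by
      rcases ht.1.eq_or_lt with rfl | h0
      · rw [sub_self, norm_zero]
        positivity
      · refine (norm_sub_zero_le_snormPos hβ0 hcont hdiff' hbdd h0 (ht.2.trans hx₁')).trans ?_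
        gcongr
        exact ht.2
    have hlin : ‖(f x₁ - f 0) / (x₁ : ℂ) * (t : ℂ)‖ ≤ ‖f x₁ - f 0‖ := by
      rw [norm_mul, norm_div, Complex.norm_of_nonneg hx₁.le, Complex.norm_of_nonneg ht.1,
        div_mul_eq_mul_div, div_le_iff₀ hx₁]
      gcongr
      exact ht.2
    rw [← sub_sub]
    calc _ ≤ ‖f t - f 0‖ + ‖(f x₁ - f 0) / (x₁ : ℂ) * (t : ℂ)‖ := norm_sub_le _ _
      _ ≤ 1 / β * x₁ ^ β * snormPos 1 β f + 1 / β * x₁ ^ β * snormPos 1 β f :=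
        add_le_add hft (hlin.trans hx)
      _ = _ := by ring
end
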